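/- arXiv:0907.2588 — 7 statements merged into one kernel-verified Lean document; each statement's English description precedes it below -/
import Mathlib

section
/- Let (V(k) : k ≥ 1) be a non-negative measurable process and Φ a positive function on the positive integers. Suppose there exists a random variable X with P(X > 0) = 1 such that V(k)/Φ(k) converges in distribution to X as k → ∞. Then, for any non-negative function f on the positive integers, P(∑_{k=1}^∞ f(k) V(k) < ∞) > 0 implies ∑_{k=1}^∞ f(k) Φ(k) < ∞. -/
open MeasureTheory ProbabilityTheory Filter
open scoped ENNReal Topology

/-- The ramp function `x ↦ max 0 (min 1 (1 - n x))`, a continuous majorant of the indicator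
of `(-∞, 0]`. -/
noncomputable def ramp (n : ℕ) : BoundedContinuousFunction ℝ ℝ :=
  BoundedContinuousFunction.ofNormedAddCommGroup (fun x => max 0 (min 1 (1 - n * x)))
    (by fun_prop) 1 (fun x => by
      rw [Real.norm_eq_abs, abs_of_nonneg (le_max_left _ _)]
      exact max_le zero_le_one (min_le_left _ _))

theorem ramp_apply (n : ℕ) (x : ℝ) : ramp n x = max 0 (min 1 (1 - n * x)) := rfl

theorem ramp_nonneg (n : ℕ) (x : ℝ) : 0 ≤ ramp n x := le_max_left _ _

theorem ramp_le_one (n : ℕ) (x : ℝ) : ramp n x ≤ 1 := max_le zero_le_one (min_le_left _ _)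

theorem one_le_mul_add_ramp (n : ℕ) {x : ℝ} (hx : 0 ≤ x) : 1 ≤ n * x + ramp n x := by
  have h : 0 ≤ (n : ℝ) * x := by positivity
  have : 1 - n * x ≤ ramp n x := by
    rw [ramp_apply, min_eq_right (by linarith)]
    exact le_max_right _ _
  linarith

theorem tendsto_ramp_zero {x : ℝ} (hx : 0 < x) :
    Tendsto (fun n : ℕ => ramp n x) atTop (𝓝 0) := by
  obtain ⟨N, hN⟩ := exists_nat_gt (1 / x)
  refine tendsto_const_nhds.congr' ?_
  filter_upwards [eventually_ge_atTop N] with n hn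
  have hn' : (N : ℝ) ≤ n := by exact_mod_cast hn
  have h1 : 1 < N * x := (div_lt_iff₀ hx).1 hN
  have h2 : (N : ℝ) * x ≤ n * x := by gcongr
  rw [ramp_apply, max_eq_left]
  exact (min_le_right _ _).trans (by linarith)

theorem tendsto_integral_ramp {Ω : Type*} [MeasurableSpace Ω] {μ : Measure Ω}
    [IsFiniteMeasure μ] {Z : Ω → ℝ} (hZ : Measurable Z) (hpos : ∀ᵐ ω ∂μ, 0 < Z ω) :
    Tendsto (fun n : ℕ => ∫ ω, ramp n (Z ω) ∂μ) atTop (𝓝 0) := by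
  have h := tendsto_integral_of_dominated_convergence (μ := μ)
    (F := fun n ω => ramp n (Z ω)) (f := fun _ => (0 : ℝ)) (fun _ => 1)
    (fun n => ((ramp n).continuous.measurable.comp hZ).aestronglyMeasurable)
    (integrable_const 1)
    (fun n => .of_forall fun ω => by
      rw [Real.norm_eq_abs, abs_of_nonneg (ramp_nonneg _ _)]
      exact ramp_le_one _ _)
    (hpos.mono fun ω hω => tendsto_ramp_zero hω)
  simpa using h

/-- If the expectation of `ramp n (V / φ)` is at most half the mass of `A`, then the integral
of `V` over `A` is bounded below by a multiple of `φ`. -/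
theorem ofReal_mul_half_le {Ω : Type*} [MeasurableSpace Ω] {μ : Measure Ω}
    [IsFiniteMeasure μ] {V : Ω → ℝ} (hV : Measurable V) (hV0 : ∀ ω, 0 ≤ V ω)
    {φ c : ℝ} (hφ : 0 < φ) (hc : 0 ≤ c) (A : Set Ω) (n : ℕ)
    (h : ∫ ω, ramp n (V ω / φ) ∂μ ≤ (μ A).toReal / 2) :
    ENNReal.ofReal (c * φ) * (μ A / 2) ≤ n * ∫⁻ ω in A, ENNReal.ofReal (c * V ω) ∂μ := by
  have hmeas : Measurable fun ω => ramp n (V ω / φ) :=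
    (ramp n).continuous.measurable.comp (hV.div_const φ)
  have hg : ∫⁻ ω in A, ENNReal.ofReal (ramp n (V ω / φ)) ∂μ ≤ μ A / 2 := by
    calc ∫⁻ ω in A, ENNReal.ofReal (ramp n (V ω / φ)) ∂μ
        ≤ ∫⁻ ω, ENNReal.ofReal (ramp n (V ω / φ)) ∂μ := setLIntegral_le_lintegral _ _
      _ = ENNReal.ofReal (∫ ω, ramp n (V ω / φ) ∂μ) := by
          refine (ofReal_integral_eq_lintegral_ofReal ?_
            (.of_forall fun _ => ramp_nonneg _ _)).symm
          refine Integrable.of_bound hmeas.aestronglyMeasurable 1 (.of_forall fun ω => ?_)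
          rw [Real.norm_eq_abs, abs_of_nonneg (ramp_nonneg _ _)]
          exact ramp_le_one _ _
      _ ≤ ENNReal.ofReal ((μ A).toReal / 2) := ENNReal.ofReal_le_ofReal h
      _ = μ A / 2 := by
          rw [ENNReal.ofReal_div_of_pos two_pos, ENNReal.ofReal_toReal (measure_ne_top μ A)]
          simp
  have hpt : ∀ ω, ENNReal.ofReal (c * φ) ≤ n * ENNReal.ofReal (c * V ω)
      + ENNReal.ofReal (c * φ) * ENNReal.ofReal (ramp n (V ω / φ)) := by
    intro ω
    have h1 := one_le_mul_add_ramp n (div_nonneg (hV0 ω) hφ.le)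
    have h2 : c * φ ≤ n * (c * V ω) + c * φ * ramp n (V ω / φ) := by
      calc c * φ = c * φ * 1 := (mul_one _).symm
        _ ≤ c * φ * (n * (V ω / φ) + ramp n (V ω / φ)) := by gcongr
        _ = _ := by field_simp
    have h3 := hV0 ω
    have h4 := ramp_nonneg n (V ω / φ)
    rw [← ENNReal.ofReal_mul (by positivity), ← ENNReal.ofReal_natCast n,
      ← ENNReal.ofReal_mul (by positivity), ← ENNReal.ofReal_add (by positivity) (by positivity)]
    exact ENNReal.ofReal_le_ofReal h2
  have hmain : ENNReal.ofReal (c * φ) * μ A ≤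
      n * ∫⁻ ω in A, ENNReal.ofReal (c * V ω) ∂μ + ENNReal.ofReal (c * φ) * (μ A / 2) := by
    calc ENNReal.ofReal (c * φ) * μ A = ∫⁻ _ in A, ENNReal.ofReal (c * φ) ∂μ := by simp
      _ ≤ ∫⁻ ω in A, (n * ENNReal.ofReal (c * V ω)
          + ENNReal.ofReal (c * φ) * ENNReal.ofReal (ramp n (V ω / φ))) ∂μ :=
        lintegral_mono hpt
      _ = n * ∫⁻ ω in A, ENNReal.ofReal (c * V ω) ∂μ
          + ENNReal.ofReal (c * φ) * ∫⁻ ω in A, ENNReal.ofReal (ramp n (V ω / φ)) ∂μ := by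
        rw [lintegral_add_left (by fun_prop), lintegral_const_mul _ (by fun_prop),
          lintegral_const_mul _ (by fun_prop)]
      _ ≤ _ := by gcongr
  have hfin : ENNReal.ofReal (c * φ) * (μ A / 2) ≠ ∞ :=
    ENNReal.mul_ne_top ENNReal.ofReal_ne_top
      (ENNReal.div_ne_top (measure_ne_top μ A) two_ne_zero)
  rw [← ENNReal.add_le_add_iff_right hfin, ← mul_add, ENNReal.add_halves]
  exact hmain

/-- A measurable function that is finite with positive probability is bounded by a constant on
a set of positive measure. -/
theorem exists_nat_measure_le_pos {Ω : Type*} [MeasurableSpace Ω] {μ : Measure Ω}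
    {S : Ω → ℝ≥0∞} (h : 0 < μ {ω | S ω < ∞}) : ∃ M : ℕ, 0 < μ {ω | S ω ≤ M} := by
  by_contra! hM
  refine h.ne' (measure_mono_null (t := ⋃ M : ℕ, {ω | S ω ≤ M}) (fun ω hω => ?_)
    (measure_iUnion_null fun M => nonpos_iff_eq_zero.1 (hM M)))
  obtain ⟨M, hM⟩ := ENNReal.exists_nat_gt (ne_of_lt hω)
  exact Set.mem_iUnion.2 ⟨M, hM.le⟩

/-- **A limit version of Jeulin's lemma in discrete time.** If the non-negative process
`V(k)`, normalized by the positive function `Φ(k)`, converges in distribution to a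
random variable `Z` with `P(Z > 0) = 1`, then for any non-negative `f`,
`P(∑_{k≥1} f(k) V(k) < ∞) > 0` implies `∑_{k≥1} f(k) Φ(k) < ∞`. -/
theorem stmt3
    {Ω : Type*} [MeasureSpace Ω] [IsProbabilityMeasure (ℙ : Measure Ω)]
    (V : ℕ → Ω → ℝ)
    (hVmeas : ∀ k, Measurable (V k))
    (hVnonneg : ∀ k, 1 ≤ k → ∀ ω, 0 ≤ V k ω)
    (Φ : ℕ → ℝ) (hΦ : ∀ k, 1 ≤ k → 0 < Φ k)
    (Z : Ω → ℝ) (hZmeas : Measurable Z)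
    (hZpos : ℙ {ω | 0 < Z ω} = 1)
    (hconv : ∀ g : BoundedContinuousFunction ℝ ℝ,
      Tendsto (fun k : ℕ => ∫ ω, g (V k ω / Φ k) ∂ℙ) atTop (𝓝 (∫ ω, g (Z ω) ∂ℙ)))
    (f : ℕ → ℝ) (hf : ∀ k, 1 ≤ k → 0 ≤ f k) :
    0 < ℙ {ω | ∑' k : ℕ, ENNReal.ofReal (f (k + 1) * V (k + 1) ω) < ∞} →
      ∑' k : ℕ, ENNReal.ofReal (f (k + 1) * Φ (k + 1)) < ∞ := by
  intro hS
  set S : Ω → ℝ≥0∞ := fun ω => ∑' k : ℕ, ENNReal.ofReal (f (k + 1) * V (k + 1) ω)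
  obtain ⟨M, hM⟩ := exists_nat_measure_le_pos (S := S) hS
  set A : Set Ω := {ω | S ω ≤ M}
  have hSmeas : Measurable S :=
    Measurable.tsum fun k => ((hVmeas (k + 1)).const_mul _).ennreal_ofReal
  have hA : MeasurableSet A := measurableSet_le hSmeas measurable_const
  have ha : 0 < (ℙ A).toReal / 2 := half_pos (ENNReal.toReal_pos hM.ne' (measure_ne_top _ _))
  have hZae : ∀ᵐ ω ∂(ℙ : Measure Ω), 0 < Z ω :=
    (prob_compl_eq_zero_iff (measurableSet_lt measurable_const hZmeas)).2 hZpos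
  obtain ⟨n, hn⟩ := ((tendsto_integral_ramp hZmeas hZae).eventually_lt_const ha).exists
  obtain ⟨K, hK⟩ := eventually_atTop.1 ((hconv (ramp n)).eventually_lt_const hn)
  have hint : ∑' k : ℕ, ∫⁻ ω in A, ENNReal.ofReal (f (k + 1) * V (k + 1) ω) ∂ℙ ≤ M * ℙ A := by
    rw [← lintegral_tsum fun k => ((hVmeas (k + 1)).const_mul _).ennreal_ofReal.aemeasurable]
    calc ∫⁻ ω in A, S ω ∂ℙ ≤ ∫⁻ _ in A, (M : ℝ≥0∞) ∂ℙ := setLIntegral_mono' hA fun _ hω => hω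
      _ = M * ℙ A := by simp
  have htail : (∑' k : ℕ, ENNReal.ofReal (f (k + K + 1) * Φ (k + K + 1))) * (ℙ A / 2)
      ≤ n * (M * ℙ A) := by
    rw [← ENNReal.tsum_mul_right]
    calc ∑' k : ℕ, ENNReal.ofReal (f (k + K + 1) * Φ (k + K + 1)) * (ℙ A / 2)
        ≤ ∑' k : ℕ, n * ∫⁻ ω in A, ENNReal.ofReal (f (k + K + 1) * V (k + K + 1) ω) ∂ℙ :=
          ENNReal.tsum_le_tsum fun k => ofReal_mul_half_le (hVmeas _)
            (hVnonneg _ (by omega)) (hΦ _ (by omega)) (hf _ (by omega)) A n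
            (hK (k + K + 1) (by omega)).le
      _ = n * ∑' k : ℕ, ∫⁻ ω in A, ENNReal.ofReal (f (k + K + 1) * V (k + K + 1) ω) ∂ℙ :=
          ENNReal.tsum_mul_left
      _ ≤ n * ∑' k : ℕ, ∫⁻ ω in A, ENNReal.ofReal (f (k + 1) * V (k + 1) ω) ∂ℙ := by
          refine mul_le_mul' le_rfl ?_
          exact ENNReal.tsum_comp_le_tsum_of_injective (add_left_injective K)
            fun k => ∫⁻ ω in A, ENNReal.ofReal (f (k + 1) * V (k + 1) ω) ∂ℙ
      _ ≤ n * (M * ℙ A) := by gcongr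
  have hlt : ∑' k : ℕ, ENNReal.ofReal (f (k + K + 1) * Φ (k + K + 1)) < ∞ := by
    refine ENNReal.lt_top_of_mul_ne_top_left (htail.trans_lt ?_).ne
      (ENNReal.div_pos hM.ne' ENNReal.ofNat_ne_top).ne'
    exact ENNReal.mul_lt_top (ENNReal.natCast_lt_top n)
      (ENNReal.mul_lt_top (ENNReal.natCast_lt_top M) (measure_lt_top _ _))
  rw [← ENNReal.summable.sum_add_tsum_nat_add' (k := K)]
  exact ENNReal.add_lt_top.2 ⟨ENNReal.sum_lt_top.2 fun _ _ => ENNReal.ofReal_lt_top, hlt⟩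
end

section
/- Let (X(t) : 0 < t ≤ 1) be a non-negative measurable process, φ a positive function on (0,1], and μ a non-negative Borel measure on (0,1]. Suppose there exists a random variable X with P(X > 0) > 0 such that X(t)/φ(t) converges in distribution to X as t → 0+, and suppose moreover that ∫_ε^1 φ(t) μ(dt) < ∞ for every 0 < ε < 1. Then P(∫_0^1 X(t) μ(dt) < ∞) = 1 implies ∫_0^1 φ(t) μ(dt) < ∞. -/
open MeasureTheory ProbabilityTheory Filter
open scoped ENNReal Topology

/-- A family of events whose probabilities are at least `2 * d` forces the reference measure
to be finite as soon as the occupation measure is almost surely finite. -/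
theorem measure_univ_lt_top_of_ae_slice_lt_top
    {T Ω : Type*} [MeasurableSpace T] [MeasurableSpace Ω] (P : Measure Ω) [IsProbabilityMeasure P]
    (ν : Measure T) [SigmaFinite ν] (A : Set (T × Ω)) (hA : MeasurableSet A)
    (d : ℝ≥0∞) (hd : d ≠ 0) (hdtop : d ≠ ∞)
    (hAd : ∀ᵐ t ∂ν, d + d ≤ P (Prod.mk t ⁻¹' A))
    (hfin : ∀ᵐ ω ∂P, ν ((fun t => (t, ω)) ⁻¹' A) < ∞) :
    ν Set.univ < ∞ := by
  set J : Ω → ℝ≥0∞ := fun ω => ν ((fun t => (t, ω)) ⁻¹' A)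
  have hJm : Measurable J := measurable_measure_prodMk_right hA
  have hlim : Tendsto (fun n : ℕ => P {ω | (n : ℝ≥0∞) < J ω}) atTop (𝓝 0) := by
    have h := tendsto_measure_iInter_atTop (μ := P) (s := fun n : ℕ => {ω | (n : ℝ≥0∞) < J ω})
      (fun n => (measurableSet_lt measurable_const hJm).nullMeasurableSet)
      (fun m n hmn ω (hω : (n : ℝ≥0∞) < J ω) =>
        show (m : ℝ≥0∞) < J ω from lt_of_le_of_lt (Nat.cast_le.2 hmn) hω)
      ⟨0, measure_ne_top _ _⟩
    have h0 : P (⋂ n : ℕ, {ω | (n : ℝ≥0∞) < J ω}) = 0 := by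
      refine measure_mono_null (fun ω hω => ?_) hfin
      intro hlt
      obtain ⟨n, hn⟩ := ENNReal.exists_nat_gt hlt.ne
      exact lt_asymm hn (Set.mem_iInter.1 hω n)
    rwa [h0] at h
  obtain ⟨n, hn⟩ := (hlim.eventually (gt_mem_nhds (pos_iff_ne_zero.2 hd))).exists
  set B : Set Ω := {ω | J ω ≤ n}
  have hBm : MeasurableSet B := measurableSet_le hJm measurable_const
  have hlow : ∀ᵐ t ∂ν, d ≤ P.restrict B (Prod.mk t ⁻¹' A) := by
    filter_upwards [hAd] with t ht
    rw [Measure.restrict_apply (measurable_prodMk_left hA)]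
    have h1 : P (Prod.mk t ⁻¹' A) ≤ P (Prod.mk t ⁻¹' A ∩ B) + d := by
      refine (measure_le_inter_add_sdiff P _ B).trans ?_
      gcongr
      refine (measure_mono ?_).trans hn.le
      exact fun ω hω => show (n : ℝ≥0∞) < J ω from not_le.1 hω.2
    exact (ENNReal.add_le_add_iff_right hdtop).1 (ht.trans h1)
  have hup : ∫⁻ ω in B, J ω ∂P ≤ n := by
    calc ∫⁻ ω in B, J ω ∂P ≤ ∫⁻ _ in B, (n : ℝ≥0∞) ∂P :=
          setLIntegral_mono measurable_const fun ω hω => hω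
      _ = n * P B := setLIntegral_const _ _
      _ ≤ n * 1 := by gcongr; exact prob_le_one
      _ = n := mul_one _
  have hswap : ∫⁻ t, P.restrict B (Prod.mk t ⁻¹' A) ∂ν = ∫⁻ ω in B, J ω ∂P := by
    rw [← Measure.prod_apply hA, Measure.prod_apply_symm hA]
  have hmul : d * ν Set.univ ≤ n := by
    rw [← lintegral_const]
    exact (lintegral_mono_ae hlow).trans (hswap.le.trans hup)
  by_contra! htop
  rw [top_le_iff.1 htop, ENNReal.mul_top hd] at hmul
  exact absurd hmul (not_le.2 (ENNReal.natCast_lt_top n))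

/-- Truncation to the unit interval, as a bounded continuous function. -/
noncomputable def unitTruncation : BoundedContinuousFunction ℝ ℝ :=
  BoundedContinuousFunction.ofNormedAddCommGroup (fun x => min (max x 0) 1) (by fun_prop) 1
    (fun x => by
      rw [Real.norm_of_nonneg (le_min (le_max_right _ _) zero_le_one)]
      exact min_le_right _ _)

theorem unitTruncation_apply (x : ℝ) : unitTruncation x = min (max x 0) 1 := rfl

theorem integral_unitTruncation_pos {Ω : Type*} [MeasurableSpace Ω] (P : Measure Ω)
    [IsProbabilityMeasure P] {Z : Ω → ℝ} (hZ : Measurable Z) (hpos : 0 < P {ω | 0 < Z ω}) :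
    0 < ∫ ω, unitTruncation (Z ω) ∂P := by
  have hint : Integrable (fun ω => unitTruncation (Z ω)) P :=
    Integrable.of_bound (unitTruncation.continuous.measurable.comp hZ).aestronglyMeasurable
      ‖unitTruncation‖ (ae_of_all _ fun ω => unitTruncation.norm_coe_le_norm _)
  have hnonneg : 0 ≤ fun ω => unitTruncation (Z ω) :=
    fun ω => le_min (le_max_right _ _) zero_le_one
  rw [integral_pos_iff_support_of_nonneg hnonneg hint]
  refine hpos.trans_le (measure_mono fun ω hω => ?_)
  exact (lt_min (lt_max_of_lt_left hω) one_pos).ne'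

theorem ofReal_le_measure_of_le_integral_unitTruncation {Ω : Type*} [MeasurableSpace Ω]
    (P : Measure Ω) [IsProbabilityMeasure P] {Y : Ω → ℝ} (hY : Measurable Y) {a b : ℝ}
    (ha : 0 ≤ a) (h : a + b ≤ ∫ ω, unitTruncation (Y ω) ∂P) :
    ENNReal.ofReal b ≤ P {ω | a ≤ Y ω} := by
  have hm : MeasurableSet {ω | a ≤ Y ω} := measurableSet_le measurable_const hY
  have hint : Integrable (fun ω => unitTruncation (Y ω)) P :=
    Integrable.of_bound (unitTruncation.continuous.measurable.comp hY).aestronglyMeasurable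
      ‖unitTruncation‖ (ae_of_all _ fun ω => unitTruncation.norm_coe_le_norm _)
  have hind : Integrable ({ω | a ≤ Y ω}.indicator (1 : Ω → ℝ)) P :=
    (integrable_const (1 : ℝ)).indicator hm
  have hle : ∫ ω, unitTruncation (Y ω) ∂P
      ≤ ∫ ω, (a + {ω | a ≤ Y ω}.indicator (1 : Ω → ℝ) ω) ∂P := by
    refine integral_mono hint ((integrable_const a).add hind) fun ω => ?_
    simp only [unitTruncation_apply]
    by_cases hω : a ≤ Y ω
    · rw [Set.indicator_of_mem (show ω ∈ {ω | a ≤ Y ω} from hω)]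
      exact (min_le_right _ _).trans (by simpa using ha)
    · rw [Set.indicator_of_notMem (show ω ∉ {ω | a ≤ Y ω} from hω), add_zero]
      exact (min_le_left _ _).trans (max_le (not_le.1 hω).le ha)
  rw [integral_add (integrable_const a) hind, integral_indicator_one hm] at hle
  simp only [integral_const, probReal_univ, one_smul] at hle
  exact ENNReal.ofReal_le_of_le_toReal (le_of_add_le_add_left (h.trans hle))

/-- A measure on `ℝ` giving no mass to `(-∞, 0]` and finite mass to every `(ε, ∞)` with `ε > 0`
is sigma-finite. -/
theorem sigmaFinite_of_measure_Ioi_lt_top (ν : Measure ℝ) (h0 : ν (Set.Iic 0) = 0)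
    (h : ∀ ε : ℝ, 0 < ε → ν (Set.Ioi ε) < ∞) : SigmaFinite ν := by
  refine ⟨⟨⟨fun n : ℕ => Set.Iic 0 ∪ Set.Ioi (1 / ((n : ℝ) + 1)), fun _ => trivial,
    fun n => ?_, ?_⟩⟩⟩
  · refine (measure_union_le _ _).trans_lt ?_
    rw [h0, zero_add]
    exact h _ Nat.one_div_pos_of_nat
  · refine Set.eq_univ_of_forall fun t => ?_
    rcases le_or_gt t 0 with ht | ht
    · exact Set.mem_iUnion.2 ⟨0, Or.inl ht⟩
    · obtain ⟨n, hn⟩ := exists_nat_one_div_lt ht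
      exact Set.mem_iUnion.2 ⟨n, Or.inr hn⟩

/-- **A limit version of Jeulin's lemma (Shiga).** Let `(X(t) : 0 < t ≤ 1)` be a
non-negative measurable process, `φ` positive on `(0,1]`, `μ` a Borel measure on
`(0,1]`. If `X(t)/φ(t)` converges in distribution as `t → 0+` to some `Z` with
`P(Z > 0) > 0` and `∫_ε^1 φ dμ < ∞` for every `0 < ε < 1`, then
`P(∫_0^1 X(t) μ(dt) < ∞) = 1` implies `∫_0^1 φ dμ < ∞`. -/
theorem stmt5
    {Ω : Type*} [MeasureSpace Ω] [IsProbabilityMeasure (ℙ : Measure Ω)]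
    (X : ℝ → Ω → ℝ)
    (hXmeas : Measurable fun p : ℝ × Ω => X p.1 p.2)
    (hXnonneg : ∀ t ∈ Set.Ioc (0 : ℝ) 1, ∀ ω, 0 ≤ X t ω)
    (φ : ℝ → ℝ) (hφ : ∀ t ∈ Set.Ioc (0 : ℝ) 1, 0 < φ t)
    (μ : Measure ℝ)
    (Z : Ω → ℝ) (hZmeas : Measurable Z)
    (hZpos : 0 < ℙ {ω | 0 < Z ω})
    (hconv : ∀ g : BoundedContinuousFunction ℝ ℝ,
      Tendsto (fun t : ℝ => ∫ ω, g (X t ω / φ t) ∂ℙ) (𝓝[>] (0 : ℝ))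
        (𝓝 (∫ ω, g (Z ω) ∂ℙ)))
    (hφint : ∀ ε : ℝ, 0 < ε → ε < 1 →
      ∫⁻ t in Set.Ioc ε 1, ENNReal.ofReal (φ t) ∂μ < ∞) :
    ℙ {ω | ∫⁻ t in Set.Ioc (0 : ℝ) 1, ENNReal.ofReal (X t ω) ∂μ < ∞} = 1 →
      ∫⁻ t in Set.Ioc (0 : ℝ) 1, ENNReal.ofReal (φ t) ∂μ < ∞ := by
  intro hone
  obtain ⟨g, hgm, hgle, hgeq⟩ := exists_measurable_le_lintegral_eq
    (μ := μ.restrict (Set.Ioc (0 : ℝ) 1)) (fun t => ENNReal.ofReal (φ t))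
  rw [hgeq]
  have hXt : ∀ t, Measurable (X t) := fun t => hXmeas.comp measurable_prodMk_left
  have hc := integral_unitTruncation_pos ℙ hZmeas hZpos
  set c := ∫ ω, unitTruncation (Z ω) ∂ℙ
  have hev := (hconv unitTruncation).eventually (lt_mem_nhds (half_lt_self hc))
  obtain ⟨u, hu, husub⟩ := mem_nhdsGT_iff_exists_Ioo_subset.1 hev
  have hu0 : 0 < u := hu
  obtain ⟨s, hs0, hs⟩ := exists_between (lt_min hu0 one_pos)
  have hs1 : s < 1 := hs.trans_le (min_le_right _ _)
  have hsu : s < u := hs.trans_le (min_le_left _ _)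
  have hgtail : ∀ ε : ℝ, 0 < ε → ε < 1 → ∫⁻ t in Set.Ioc ε 1, g t ∂μ < ∞ := fun ε h0 h1 =>
    (lintegral_mono hgle).trans_lt (hφint ε h0 h1)
  let ν := (μ.restrict (Set.Ioc 0 s)).withDensity g
  have hνac : ν ≪ μ.restrict (Set.Ioc 0 s) := withDensity_absolutelyContinuous _ _
  have hνsig : SigmaFinite ν := by
    refine sigmaFinite_of_measure_Ioi_lt_top ν (hνac ?_) fun ε hε => ?_
    · rw [Measure.restrict_apply measurableSet_Iic]
      convert measure_empty (μ := μ)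
      ext t
      simp only [Set.mem_inter_iff, Set.mem_Iic, Set.mem_Ioc, Set.mem_empty_iff_false, iff_false]
      exact fun h => absurd h.2.1 (not_lt.2 h.1)
    · have hε' : 0 < min ε s := lt_min hε hs0
      rw [withDensity_apply _ measurableSet_Ioi, Measure.restrict_restrict measurableSet_Ioi]
      refine (lintegral_mono_set ?_).trans_lt
        (hgtail (min ε s) hε' ((min_le_right _ _).trans_lt hs1))
      exact fun t ht => ⟨(min_le_left _ _).trans_lt ht.1, ht.2.2.trans hs1.le⟩
  set a : ℝ := c / 4 with ha
  have ha0 : 0 < a := by positivity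
  let A : Set (ℝ × Ω) := {p | ENNReal.ofReal a * g p.1 ≤ ENNReal.ofReal (X p.1 p.2)}
  have hA : MeasurableSet A :=
    measurableSet_le (measurable_const.mul (hgm.comp measurable_fst)) hXmeas.ennreal_ofReal
  have hAd : ∀ᵐ t ∂ν, ENNReal.ofReal (a / 2) + ENNReal.ofReal (a / 2)
      ≤ ℙ (Prod.mk t ⁻¹' A) := by
    refine hνac.ae_le ?_
    filter_upwards [ae_restrict_mem measurableSet_Ioc] with t ht
    have hφt := hφ t ⟨ht.1, ht.2.trans hs1.le⟩
    have hct : c / 2 < ∫ ω, unitTruncation (X t ω / φ t) ∂ℙ :=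
      husub ⟨ht.1, ht.2.trans_lt hsu⟩
    rw [← ENNReal.ofReal_add (by positivity) (by positivity), add_halves]
    refine (ofReal_le_measure_of_le_integral_unitTruncation ℙ ((hXt t).div_const (φ t)) ha0.le
      (b := a) (by linarith)).trans (measure_mono fun ω hω => ?_)
    have hω' : a * φ t ≤ X t ω := (le_div_iff₀ hφt).1 hω
    calc ENNReal.ofReal a * g t ≤ ENNReal.ofReal a * ENNReal.ofReal (φ t) := by
          gcongr; exact hgle t
      _ = ENNReal.ofReal (a * φ t) := (ENNReal.ofReal_mul ha0.le).symm
      _ ≤ ENNReal.ofReal (X t ω) := ENNReal.ofReal_le_ofReal hω'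
  have hslice : ∀ ω, ENNReal.ofReal a * ν ((fun t => (t, ω)) ⁻¹' A)
      ≤ ∫⁻ t in Set.Ioc (0 : ℝ) 1, ENNReal.ofReal (X t ω) ∂μ := fun ω => by
    have hAω : MeasurableSet ((fun t => (t, ω)) ⁻¹' A) := measurable_prodMk_right hA
    rw [withDensity_apply _ hAω, ← lintegral_const_mul _ hgm]
    calc ∫⁻ t in (fun t => (t, ω)) ⁻¹' A, ENNReal.ofReal a * g t ∂μ.restrict (Set.Ioc 0 s)
        ≤ ∫⁻ t in (fun t => (t, ω)) ⁻¹' A, ENNReal.ofReal (X t ω) ∂μ.restrict (Set.Ioc 0 s) :=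
          setLIntegral_mono' hAω fun t ht => ht
      _ ≤ ∫⁻ t in Set.Ioc 0 s, ENNReal.ofReal (X t ω) ∂μ := setLIntegral_le_lintegral _ _
      _ ≤ _ := lintegral_mono_set (Set.Ioc_subset_Ioc_right hs1.le)
  have hfin : ∀ᵐ ω ∂ℙ, ν ((fun t => (t, ω)) ⁻¹' A) < ∞ := by
    have hm : MeasurableSet {ω | ν ((fun t => (t, ω)) ⁻¹' A) < ∞} :=
      measurableSet_lt (measurable_measure_prodMk_right hA) measurable_const
    refine (mem_ae_iff_prob_eq_one hm).2 (le_antisymm prob_le_one ?_)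
    rw [← hone]
    refine measure_mono fun ω hω => ?_
    exact ENNReal.lt_top_of_mul_ne_top_right ((hslice ω).trans_lt hω).ne
      (ENNReal.ofReal_pos.2 ha0).ne'
  have hν := measure_univ_lt_top_of_ae_slice_lt_top ℙ ν A hA (ENNReal.ofReal (a / 2))
    (ENNReal.ofReal_pos.2 (half_pos ha0)).ne' ENNReal.ofReal_ne_top hAd hfin
  rw [withDensity_apply _ MeasurableSet.univ, Measure.restrict_univ] at hν
  rw [← Set.Ioc_union_Ioc_eq_Ioc hs0.le hs1.le]
  exact (lintegral_union_le _ _ _).trans_lt (ENNReal.add_lt_top.2 ⟨hν, hgtail s hs0 hs1⟩)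
end

section
/- Let (V(k) : k ≥ 1) be a non-negative measurable process and Φ a positive function on the positive integers. Suppose there exists a random variable X with P(X > 0) > 0 such that V(k)/Φ(k) converges in distribution to X as k → ∞. Then, for any non-negative function f on the positive integers, P(∑_{k=1}^∞ f(k) V(k) < ∞) = 1 implies ∑_{k=1}^∞ f(k) Φ(k) < ∞. -/
open MeasureTheory ProbabilityTheory Filter
open scoped ENNReal Topology

/-- An almost everywhere finite random variable has tails of arbitrarily small probability. -/
theorem exists_nat_measure_lt_of_ae_lt_top {Ω : Type*} [MeasurableSpace Ω] {μ : Measure Ω}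
    [IsFiniteMeasure μ] {S : Ω → ℝ≥0∞} (hS : Measurable S) (hfin : ∀ᵐ ω ∂μ, S ω < ∞)
    {δ : ℝ≥0∞} (hδ : 0 < δ) : ∃ M : ℕ, μ {ω | (M : ℝ≥0∞) < S ω} < δ := by
  have hlim : Tendsto (fun n : ℕ => μ {ω | (n : ℝ≥0∞) < S ω}) atTop
      (𝓝 (μ (⋂ n : ℕ, {ω | (n : ℝ≥0∞) < S ω}))) := by
    refine tendsto_measure_iInter_atTop
      (fun n => (measurableSet_lt measurable_const hS).nullMeasurableSet) ?_
      ⟨0, measure_ne_top _ _⟩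
    intro m n hmn ω hω
    exact lt_of_le_of_lt (Nat.cast_le.2 hmn) (show (n : ℝ≥0∞) < S ω from hω)
  have hzero : μ (⋂ n : ℕ, {ω | (n : ℝ≥0∞) < S ω}) = 0 := by
    refine measure_mono_null ?_ (ae_iff.1 hfin)
    intro ω hω hlt
    obtain ⟨n, hn⟩ := ENNReal.exists_nat_gt hlt.ne
    exact lt_asymm hn (Set.mem_iInter.1 hω n)
  rw [hzero] at hlim
  exact (hlim.eventually (gt_mem_nhds hδ)).exists

/-- The bounded continuous function `x ↦ min (max x 0) 1`. -/
noncomputable def unitClamp : BoundedContinuousFunction ℝ ℝ :=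
  BoundedContinuousFunction.ofNormedAddCommGroup (fun x => min (max x 0) 1) (by fun_prop) 1
    (fun x => by
      rw [Real.norm_eq_abs, abs_of_nonneg (le_min (le_max_right _ _) zero_le_one)]
      exact min_le_right _ _)

theorem unitClamp_apply (x : ℝ) : unitClamp x = min (max x 0) 1 := rfl

theorem unitClamp_nonneg (x : ℝ) : 0 ≤ unitClamp x :=
  le_min (le_max_right _ _) zero_le_one

theorem unitClamp_le_one (x : ℝ) : unitClamp x ≤ 1 := min_le_right _ _

theorem integrable_unitClamp_comp {Ω : Type*} [MeasurableSpace Ω] {μ : Measure Ω}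
    [IsFiniteMeasure μ] {W : Ω → ℝ} (hW : Measurable W) :
    Integrable (fun ω => unitClamp (W ω)) μ :=
  .of_bound (unitClamp.continuous.measurable.comp hW).aestronglyMeasurable 1
    (ae_of_all _ fun ω => by
      rw [Real.norm_eq_abs, abs_of_nonneg (unitClamp_nonneg _)]
      exact unitClamp_le_one _)

theorem integral_unitClamp_comp_pos {Ω : Type*} [MeasurableSpace Ω] {μ : Measure Ω}
    [IsFiniteMeasure μ] {W : Ω → ℝ} (hW : Measurable W) (hpos : 0 < μ {ω | 0 < W ω}) :
    0 < ∫ ω, unitClamp (W ω) ∂μ := by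
  rw [integral_pos_iff_support_of_nonneg (fun ω => unitClamp_nonneg _)
    (integrable_unitClamp_comp hW)]
  refine hpos.trans_le (measure_mono fun ω hω => ?_)
  have hω' : 0 < W ω := hω
  rw [Function.mem_support, unitClamp_apply]
  exact (lt_min (lt_max_of_lt_left hω') one_pos).ne'

/-- Removing a set of small measure costs little of the truncated mean. -/
theorem ofReal_le_setLIntegral_of_lt_integral_unitClamp {Ω : Type*} [MeasurableSpace Ω]
    {μ : Measure Ω} [IsFiniteMeasure μ] {W : Ω → ℝ} (hW : Measurable W) {A : Set Ω}
    (hA : MeasurableSet A) {ε : ℝ} (hε : 0 ≤ ε) (hAc : μ Aᶜ ≤ ENNReal.ofReal ε)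
    (h : 2 * ε ≤ ∫ ω, unitClamp (W ω) ∂μ) :
    ENNReal.ofReal ε ≤ ∫⁻ ω in A, ENNReal.ofReal (W ω) ∂μ := by
  have hclamp : ∫⁻ ω in A, ENNReal.ofReal (unitClamp (W ω)) ∂μ
      ≤ ∫⁻ ω in A, ENNReal.ofReal (W ω) ∂μ := by
    refine lintegral_mono fun ω => ?_
    calc ENNReal.ofReal (unitClamp (W ω)) ≤ ENNReal.ofReal (max (W ω) 0) :=
          ENNReal.ofReal_le_ofReal (min_le_left _ _)
      _ = ENNReal.ofReal (W ω) := by simp [ENNReal.ofReal_max]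
  have hcompl : ∫⁻ ω in Aᶜ, ENNReal.ofReal (unitClamp (W ω)) ∂μ ≤ ENNReal.ofReal ε :=
    calc ∫⁻ ω in Aᶜ, ENNReal.ofReal (unitClamp (W ω)) ∂μ ≤ ∫⁻ _ in Aᶜ, 1 ∂μ :=
          lintegral_mono fun ω => ENNReal.ofReal_le_one.2 (unitClamp_le_one _)
      _ = μ Aᶜ := setLIntegral_one _
      _ ≤ ENNReal.ofReal ε := hAc
  have hsum : ENNReal.ofReal ε + ENNReal.ofReal ε
      ≤ (∫⁻ ω in A, ENNReal.ofReal (W ω) ∂μ) + ENNReal.ofReal ε :=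
    calc ENNReal.ofReal ε + ENNReal.ofReal ε = ENNReal.ofReal (2 * ε) := by
          rw [← ENNReal.ofReal_add hε hε, two_mul]
      _ ≤ ENNReal.ofReal (∫ ω, unitClamp (W ω) ∂μ) := ENNReal.ofReal_le_ofReal h
      _ = ∫⁻ ω, ENNReal.ofReal (unitClamp (W ω)) ∂μ :=
          ofReal_integral_eq_lintegral_ofReal (integrable_unitClamp_comp hW)
            (ae_of_all _ fun ω => unitClamp_nonneg _)
      _ = (∫⁻ ω in A, ENNReal.ofReal (unitClamp (W ω)) ∂μ)
            + ∫⁻ ω in Aᶜ, ENNReal.ofReal (unitClamp (W ω)) ∂μ :=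
          (lintegral_add_compl _ hA).symm
      _ ≤ _ := add_le_add hclamp hcompl
  exact (ENNReal.add_le_add_iff_right ENNReal.ofReal_ne_top).1 hsum

/-- **A limit version of Jeulin's lemma in discrete time (Shiga's version).** If
`V(k)/Φ(k)` converges in distribution to a random variable `Z` with `P(Z > 0) > 0`,
then for any non-negative `f`, `P(∑_{k≥1} f(k) V(k) < ∞) = 1` implies
`∑_{k≥1} f(k) Φ(k) < ∞`. -/
theorem stmt6
    {Ω : Type*} [MeasureSpace Ω] [IsProbabilityMeasure (ℙ : Measure Ω)]
    (V : ℕ → Ω → ℝ)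
    (hVmeas : ∀ k, Measurable (V k))
    (hVnonneg : ∀ k, 1 ≤ k → ∀ ω, 0 ≤ V k ω)
    (Φ : ℕ → ℝ) (hΦ : ∀ k, 1 ≤ k → 0 < Φ k)
    (Z : Ω → ℝ) (hZmeas : Measurable Z)
    (hZpos : 0 < ℙ {ω | 0 < Z ω})
    (hconv : ∀ g : BoundedContinuousFunction ℝ ℝ,
      Tendsto (fun k : ℕ => ∫ ω, g (V k ω / Φ k) ∂ℙ) atTop (𝓝 (∫ ω, g (Z ω) ∂ℙ)))
    (f : ℕ → ℝ) (hf : ∀ k, 1 ≤ k → 0 ≤ f k) :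
    ℙ {ω | ∑' k : ℕ, ENNReal.ofReal (f (k + 1) * V (k + 1) ω) < ∞} = 1 →
      ∑' k : ℕ, ENNReal.ofReal (f (k + 1) * Φ (k + 1)) < ∞ := by
  intro hS
  set S : Ω → ℝ≥0∞ := fun ω => ∑' k : ℕ, ENNReal.ofReal (f (k + 1) * V (k + 1) ω)
  have hterm : ∀ k, Measurable fun ω => ENNReal.ofReal (f (k + 1) * V (k + 1) ω) := fun k =>
    ((hVmeas (k + 1)).const_mul _).ennreal_ofReal
  have hSmeas : Measurable S := .tsum hterm
  have hSfin : ∀ᵐ ω ∂(ℙ : Measure Ω), S ω < ∞ :=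
    (mem_ae_iff_prob_eq_one (measurableSet_lt hSmeas measurable_const)).2 hS
  have hc := integral_unitClamp_comp_pos hZmeas hZpos
  obtain ⟨ε, hε, hε2⟩ : ∃ ε : ℝ, 0 < ε ∧ 2 * ε < ∫ ω, unitClamp (Z ω) ∂ℙ :=
    ⟨(∫ ω, unitClamp (Z ω) ∂ℙ) / 3, by positivity, by linarith⟩
  obtain ⟨M, hM⟩ := exists_nat_measure_lt_of_ae_lt_top hSmeas hSfin (ENNReal.ofReal_pos.2 hε)
  obtain ⟨N, hN⟩ := eventually_atTop.1 ((hconv unitClamp).eventually (lt_mem_nhds hε2))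
  set A : Set Ω := {ω | S ω ≤ M}
  have hA : MeasurableSet A := measurableSet_le hSmeas measurable_const
  have hAc : ℙ Aᶜ ≤ ENNReal.ofReal ε := by
    have hcompl : Aᶜ = {ω | (M : ℝ≥0∞) < S ω} := by
      ext ω
      simp [A]
    exact hcompl ▸ hM.le
  have hbound : ∀ k, ENNReal.ofReal ε * ENNReal.ofReal (f (k + N + 1) * Φ (k + N + 1))
      ≤ ∫⁻ ω in A, ENNReal.ofReal (f (k + N + 1) * V (k + N + 1) ω) ∂ℙ := by
    intro k
    have hΦk := hΦ (k + N + 1) (by omega)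
    have hfk := hf (k + N + 1) (by omega)
    have hWmeas : Measurable fun ω => V (k + N + 1) ω / Φ (k + N + 1) :=
      (hVmeas _).div_const _
    have hle := ofReal_le_setLIntegral_of_lt_integral_unitClamp hWmeas hA hε.le hAc
      (hN (k + N + 1) (by omega)).le
    calc ENNReal.ofReal ε * ENNReal.ofReal (f (k + N + 1) * Φ (k + N + 1))
        ≤ (∫⁻ ω in A, ENNReal.ofReal (V (k + N + 1) ω / Φ (k + N + 1)) ∂ℙ)
            * ENNReal.ofReal (f (k + N + 1) * Φ (k + N + 1)) := by gcongr
      _ = ∫⁻ ω in A, ENNReal.ofReal (f (k + N + 1) * V (k + N + 1) ω) ∂ℙ := by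
        rw [← lintegral_mul_const _ hWmeas.ennreal_ofReal]
        refine lintegral_congr fun ω => ?_
        rw [← ENNReal.ofReal_mul' (by positivity)]
        congr 1
        field_simp
  have htail : ENNReal.ofReal ε * ∑' k, ENNReal.ofReal (f (k + N + 1) * Φ (k + N + 1)) ≤ M :=
    calc ENNReal.ofReal ε * ∑' k, ENNReal.ofReal (f (k + N + 1) * Φ (k + N + 1))
        ≤ ∑' k, ∫⁻ ω in A, ENNReal.ofReal (f (k + N + 1) * V (k + N + 1) ω) ∂ℙ := by
          rw [← ENNReal.tsum_mul_left]
          exact ENNReal.tsum_le_tsum hbound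
      _ = ∫⁻ ω in A, ∑' k, ENNReal.ofReal (f (k + N + 1) * V (k + N + 1) ω) ∂ℙ :=
          (lintegral_tsum fun k => (hterm (k + N)).aemeasurable).symm
      _ ≤ ∫⁻ _ in A, (M : ℝ≥0∞) ∂ℙ := by
          refine setLIntegral_mono measurable_const fun ω hω => le_trans ?_ hω
          exact ENNReal.tsum_comp_le_tsum_of_injective (add_left_injective N)
            fun k => ENNReal.ofReal (f (k + 1) * V (k + 1) ω)
      _ ≤ M := by
          rw [setLIntegral_const]
          exact mul_le_of_le_one_right' prob_le_one
  have htail_lt : ∑' k, ENNReal.ofReal (f (k + N + 1) * Φ (k + N + 1)) < ∞ :=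
    ENNReal.lt_top_of_mul_ne_top_right
      (htail.trans_lt (ENNReal.natCast_lt_top M)).ne (ENNReal.ofReal_pos.2 hε).ne'
  rw [← ENNReal.summable.sum_add_tsum_nat_add' (k := N)]
  exact ENNReal.add_lt_top.2 ⟨ENNReal.sum_lt_top.2 fun _ _ => ENNReal.ofReal_lt_top, htail_lt⟩
end

section
/- There exist a probability space carrying a non-negative measurable process (X(t) : 0 < t ≤ 1), a positive function φ on (0,1], a random variable X, and a non-negative Borel measure μ on (0,1] such that: E[X] = ∞ and P(X > 0) = 1; for each fixed 0 < t ≤ 1 the random variable X(t)/φ(t) has the same law as X; ∫_0^1 φ(t) μ(dt) < ∞; and yet almost surely ∫_ε^1 X(t) μ(dt) < ∞ for every ε > 0 while ∫_0^1 X(t) μ(dt) = ∞. (Hence the hypothesis E[X] < ∞ cannot be removed from Jeulin's lemma.) -/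
open MeasureTheory ProbabilityTheory Filter
open scoped ENNReal Topology

namespace JeulinCounterexample

/-- The variable `Z(u) = ‖u‖⁻⁴` on the unit circle. -/
noncomputable def invNormPow (u : UnitAddCircle) : ℝ := (‖u‖ ^ 4)⁻¹

/-- The process `X(t) = t² Z(· - √(1/t))`. -/
noncomputable def shiftedPow (t : ℝ) (u : UnitAddCircle) : ℝ :=
  t ^ 2 * invNormPow (u - ((√t⁻¹ : ℝ) : UnitAddCircle))

/-- The measure with unit atoms at the points `1 / (n + 1)`. -/
noncomputable def atoms : Measure ℝ :=
  Measure.sum fun n : ℕ => Measure.dirac (1 / ((n : ℝ) + 1))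

lemma measurable_invNormPow : Measurable invNormPow := by
  unfold invNormPow
  fun_prop

lemma measurable_shiftedPow : Measurable (fun p : ℝ × UnitAddCircle => shiftedPow p.1 p.2) := by
  have h : Measurable fun p : ℝ × UnitAddCircle => ((√p.1⁻¹ : ℝ) : UnitAddCircle) :=
    AddCircle.measurable_mk'.comp (by fun_prop)
  exact (measurable_fst.pow_const 2).mul
    (measurable_invNormPow.comp (measurable_snd.sub h))

lemma shiftedPow_nonneg (t : ℝ) (u : UnitAddCircle) : 0 ≤ shiftedPow t u := by
  unfold shiftedPow invNormPow
  positivity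

lemma volume_singleton (v : UnitAddCircle) : volume ({v} : Set UnitAddCircle) = 0 := by
  simpa using AddCircle.volume_closedBall (1 : ℝ) (x := v) 0

lemma ae_ne (v : UnitAddCircle) : ∀ᵐ u : UnitAddCircle, u ≠ v := by
  simpa [ae_iff] using volume_singleton v

lemma invNormPow_pos {u : UnitAddCircle} (hu : u ≠ 0) : 0 < invNormPow u := by
  have := norm_pos_iff.2 hu
  unfold invNormPow
  positivity

lemma one_div_mem_Ioc (n : ℕ) : 1 / ((n : ℝ) + 1) ∈ Set.Ioc (0 : ℝ) 1 := by
  refine ⟨by positivity, ?_⟩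
  rw [div_le_one (by positivity)]
  linarith [n.cast_nonneg (α := ℝ)]

lemma setLIntegral_atoms {s : Set ℝ} (hs : MeasurableSet s) (f : ℝ → ℝ≥0∞) :
    ∫⁻ t in s, f t ∂atoms = ∑' n : ℕ, s.indicator f (1 / ((n : ℝ) + 1)) := by
  rw [← lintegral_indicator hs, atoms, lintegral_sum_measure]
  simp only [lintegral_dirac]

lemma setLIntegral_atoms_Ioc_zero (f : ℝ → ℝ≥0∞) :
    ∫⁻ t in Set.Ioc (0 : ℝ) 1, f t ∂atoms = ∑' n : ℕ, f (1 / ((n : ℝ) + 1)) := by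
  rw [setLIntegral_atoms measurableSet_Ioc]
  exact tsum_congr fun n => Set.indicator_of_mem (one_div_mem_Ioc n) f

lemma setLIntegral_atoms_Ioc_lt_top {ε : ℝ} (hε : 0 < ε) (f : ℝ → ℝ) :
    ∫⁻ t in Set.Ioc ε 1, ENNReal.ofReal (f t) ∂atoms < ∞ := by
  obtain ⟨N, hN⟩ := exists_nat_one_div_lt hε
  rw [setLIntegral_atoms measurableSet_Ioc, tsum_eq_sum (s := Finset.range N)]
  · refine ENNReal.sum_lt_top.2 fun n _ => ?_
    by_cases h : 1 / ((n : ℝ) + 1) ∈ Set.Ioc ε 1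
    · rw [Set.indicator_of_mem h]
      exact ENNReal.ofReal_lt_top
    · rw [Set.indicator_of_notMem h]
      exact ENNReal.zero_lt_top
  · intro n hn
    refine Set.indicator_of_notMem (fun h => ?_) _
    have hNn : (N : ℝ) ≤ n := by simpa using hn
    have : 1 / ((n : ℝ) + 1) ≤ 1 / ((N : ℝ) + 1) := by gcongr
    linarith [h.1]

lemma setLIntegral_atoms_sq_lt_top :
    ∫⁻ t in Set.Ioc (0 : ℝ) 1, ENNReal.ofReal (t ^ 2) ∂atoms < ∞ := by
  rw [setLIntegral_atoms_Ioc_zero]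
  have h : Summable fun n : ℕ => (1 / ((n : ℝ) + 1)) ^ 2 := by
    have := (summable_nat_add_iff 1).2 (Real.summable_one_div_nat_pow.2 one_lt_two)
    simpa using this
  exact h.tsum_ofReal_lt_top

lemma exists_le_norm_sub_sqrt (u : UnitAddCircle) (N : ℕ) :
    ∃ n, N ≤ n ∧ ‖u - ((√((n : ℝ) + 1) : ℝ) : UnitAddCircle)‖ ^ 4 * ((n : ℝ) + 1) ^ 2 ≤ 1 := by
  obtain ⟨x, rfl⟩ := QuotientAddGroup.mk_surjective u
  obtain ⟨m, hm⟩ := exists_nat_ge ((N : ℝ) + 1 - x)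
  set y := x + m with hy
  have hyN : (N : ℝ) + 1 ≤ y := by linarith
  have hN0 := N.cast_nonneg (α := ℝ)
  have hle : N + 1 ≤ ⌊y ^ 2⌋₊ := by
    refine Nat.le_floor ?_
    push_cast
    nlinarith
  obtain ⟨n, hn⟩ : ∃ n, ⌊y ^ 2⌋₊ = n + 1 := ⟨⌊y ^ 2⌋₊ - 1, by omega⟩
  refine ⟨n, by omega, ?_⟩
  have h1 : (n : ℝ) + 1 ≤ y ^ 2 := by
    have := Nat.floor_le (sq_nonneg y)
    rw [hn] at this
    exact_mod_cast this
  have h2 : y ^ 2 < (n : ℝ) + 1 + 1 := by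
    have := Nat.lt_floor_add_one (y ^ 2)
    rw [hn] at this
    exact_mod_cast this
  set s := √((n : ℝ) + 1) with hs
  have hs0 : 0 ≤ s := Real.sqrt_nonneg _
  have hs2 : s ^ 2 = (n : ℝ) + 1 := Real.sq_sqrt (by positivity)
  have hsy : s ≤ y := abs_le_of_sq_le_sq' (by linarith) (by linarith) |>.2
  have hnorm : ‖(x : UnitAddCircle) - (s : UnitAddCircle)‖ ≤ y - s := by
    have hxy : (x : UnitAddCircle) - (s : UnitAddCircle) = ((y - s : ℝ) : UnitAddCircle) := by
      have hm0 : ((m : ℝ) : UnitAddCircle) = 0 := by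
        have := AddCircle.coe_nsmul (p := (1 : ℝ)) (n := m) (x := 1)
        simpa [AddCircle.coe_period] using this
      rw [AddCircle.coe_sub, hy, AddCircle.coe_add, hm0, add_zero]
    rw [hxy]
    refine QuotientAddGroup.norm_mk_le_norm.trans ?_
    rw [Real.norm_eq_abs, abs_of_nonneg (by linarith)]
  rw [← hs2]
  calc _ = (‖(x : UnitAddCircle) - (s : UnitAddCircle)‖ * s) ^ 4 := by
        rw [mul_pow, ← pow_mul]
    _ ≤ 1 ^ 4 := by
        gcongr
        calc _ ≤ (y - s) * s := by gcongr
          _ ≤ 1 := by nlinarith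
    _ = 1 := one_pow 4

lemma tsum_shiftedPow_eq_top {u : UnitAddCircle}
    (hu : ∀ n : ℕ, u ≠ ((√((n : ℝ) + 1) : ℝ) : UnitAddCircle)) :
    ∑' n : ℕ, ENNReal.ofReal (shiftedPow (1 / ((n : ℝ) + 1)) u) = ∞ := by
  by_contra h
  have ht := ENNReal.tendsto_cofinite_zero_of_tsum_ne_top h
  rw [Nat.cofinite_eq_atTop] at ht
  obtain ⟨N, hN⟩ := eventually_atTop.1 (ht.eventually_lt_const one_pos)
  obtain ⟨n, hn, hle⟩ := exists_le_norm_sub_sqrt u N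
  refine (hN n hn).not_ge ?_
  have hpos := norm_pos_iff.2 (sub_ne_zero.2 (hu n))
  rw [ENNReal.one_le_ofReal]
  simp only [shiftedPow, invNormPow, one_div, inv_inv]
  rw [inv_pow, ← mul_inv, mul_comm]
  exact (one_le_inv₀ (by positivity)).2 hle

lemma ae_tsum_shiftedPow_eq_top :
    ∀ᵐ u : UnitAddCircle, ∑' n : ℕ, ENNReal.ofReal (shiftedPow (1 / ((n : ℝ) + 1)) u) = ∞ := by
  filter_upwards [ae_all_iff.2 fun n : ℕ => ae_ne ((√((n : ℝ) + 1) : ℝ) : UnitAddCircle)]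
    with u hu using tsum_shiftedPow_eq_top hu

lemma lintegral_shiftedPow (t : ℝ) :
    ∫⁻ u, ENNReal.ofReal (shiftedPow t u) =
      ENNReal.ofReal (t ^ 2) * ∫⁻ u, ENNReal.ofReal (invNormPow u) := by
  simp only [shiftedPow, ENNReal.ofReal_mul (sq_nonneg t)]
  rw [lintegral_const_mul' _ _ ENNReal.ofReal_ne_top]
  congr 1
  exact (measurePreserving_sub_right volume ((√t⁻¹ : ℝ) : UnitAddCircle)).lintegral_comp
    measurable_invNormPow.ennreal_ofReal

lemma lintegral_invNormPow : ∫⁻ u, ENNReal.ofReal (invNormPow u) = ∞ := by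
  by_contra h
  have hmeas (n : ℕ) :
      Measurable fun u => ENNReal.ofReal (shiftedPow (1 / ((n : ℝ) + 1)) u) :=
    (measurable_shiftedPow.comp measurable_prodMk_left).ennreal_ofReal
  have hfin : ∫⁻ u, ∑' n : ℕ, ENNReal.ofReal (shiftedPow (1 / ((n : ℝ) + 1)) u) ≠ ∞ := by
    rw [lintegral_tsum fun n => (hmeas n).aemeasurable]
    simp only [lintegral_shiftedPow]
    rw [ENNReal.tsum_mul_right, ← setLIntegral_atoms_Ioc_zero fun t => ENNReal.ofReal (t ^ 2)]
    exact ENNReal.mul_ne_top setLIntegral_atoms_sq_lt_top.ne h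
  rw [lintegral_congr_ae ae_tsum_shiftedPow_eq_top] at hfin
  simp at hfin

end JeulinCounterexample

open JeulinCounterexample

/-- **Counterexample to Jeulin's lemma without `E[X] < ∞` (Shiga).** There exist a
probability space, a non-negative measurable process `(X(t) : 0 < t ≤ 1)`, a positive
function `φ` on `(0,1]`, a random variable `Z` with `E[Z] = ∞` and `P(Z > 0) = 1` such
that `X(t)/φ(t)` has the same law as `Z` for each `t ∈ (0,1]`, and a Borel measure `μ`
on `(0,1]` with `∫_0^1 φ dμ < ∞`, while almost surely `∫_ε^1 X(t) μ(dt) < ∞` for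
every `ε > 0` but `∫_0^1 X(t) μ(dt) = ∞`. -/
theorem stmt7 :
    ∃ (Ω : Type) (_ : MeasurableSpace Ω) (P : Measure Ω)
      (X : ℝ → Ω → ℝ) (φ : ℝ → ℝ) (Z : Ω → ℝ) (μ : Measure ℝ),
      IsProbabilityMeasure P ∧
      Measurable (fun p : ℝ × Ω => X p.1 p.2) ∧
      (∀ t ∈ Set.Ioc (0 : ℝ) 1, ∀ ω, 0 ≤ X t ω) ∧
      (∀ t ∈ Set.Ioc (0 : ℝ) 1, 0 < φ t) ∧
      Measurable Z ∧
      (∫⁻ ω, ENNReal.ofReal (Z ω) ∂P = ∞) ∧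
      P {ω | 0 < Z ω} = 1 ∧
      (∀ t ∈ Set.Ioc (0 : ℝ) 1,
        Measure.map (fun ω => X t ω / φ t) P = Measure.map Z P) ∧
      (∫⁻ t in Set.Ioc (0 : ℝ) 1, ENNReal.ofReal (φ t) ∂μ < ∞) ∧
      P {ω | (∀ ε : ℝ, 0 < ε →
              ∫⁻ t in Set.Ioc ε 1, ENNReal.ofReal (X t ω) ∂μ < ∞) ∧
             (∫⁻ t in Set.Ioc (0 : ℝ) 1, ENNReal.ofReal (X t ω) ∂μ = ∞)} = 1 := by
  have hprob : IsProbabilityMeasure (volume : Measure UnitAddCircle) :=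
    ⟨UnitAddCircle.measure_univ⟩
  refine ⟨UnitAddCircle, inferInstance, volume, shiftedPow, fun t => t ^ 2, invNormPow, atoms,
    hprob, measurable_shiftedPow, fun t _ u => shiftedPow_nonneg t u,
    fun t ht => pow_pos ht.1 2,
    measurable_invNormPow, lintegral_invNormPow, ?_, fun t ht => ?_,
    setLIntegral_atoms_sq_lt_top, ?_⟩
  · rw [← mem_ae_iff_prob_eq_one (measurableSet_lt measurable_const measurable_invNormPow)]
    filter_upwards [ae_ne 0] with u hu using invNormPow_pos hu
  · have ht0 : t ^ 2 ≠ 0 := (pow_pos ht.1 2).ne'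
    have hmp := measurePreserving_sub_right (volume : Measure UnitAddCircle)
      ((√t⁻¹ : ℝ) : UnitAddCircle)
    simp only [shiftedPow, mul_div_cancel_left₀ _ ht0]
    rw [← hmp.map_eq, Measure.map_map measurable_invNormPow hmp.measurable, hmp.map_eq]
    rfl
  · refine (measure_congr (eventuallyEq_univ.2 ?_)).trans measure_univ
    filter_upwards [ae_tsum_shiftedPow_eq_top] with u hu
    exact ⟨fun ε hε => setLIntegral_atoms_Ioc_lt_top hε fun t => shiftedPow t u,
      (setLIntegral_atoms_Ioc_zero fun t => ENNReal.ofReal (shiftedPow t u)).trans hu⟩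
end

section
/- There exist a probability space carrying a non-negative measurable process (V(k) : k ≥ 1), a positive function Φ on the positive integers, and a non-negative function f on the positive integers such that: V(k)/Φ(k) converges in distribution to the constant 1 as k → ∞; ∑_{k=1}^∞ f(k) Φ(k) < ∞; but P(∑_{k=1}^∞ f(k) V(k) = ∞) = 1. (This is a counterexample to the converse implication in the discrete limit version of Jeulin's lemma.) -/
open MeasureTheory ProbabilityTheory Filter
open scoped ENNReal Topology

/-- The typewriter sequence of dyadic intervals: for `k = 2 ^ m + j` with `j < 2 ^ m` this is
`[j / 2 ^ m, (j + 1) / 2 ^ m)`. -/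
def typewriter (k : ℕ) : Set ℝ :=
  Set.Ico ((k : ℝ) / 2 ^ Nat.log 2 k - 1) (((k : ℝ) + 1) / 2 ^ Nat.log 2 k - 1)

lemma measurableSet_typewriter (k : ℕ) : MeasurableSet (typewriter k) := measurableSet_Ico

lemma volume_typewriter (k : ℕ) :
    volume (typewriter k) = ENNReal.ofReal ((2 ^ Nat.log 2 k)⁻¹) := by
  rw [typewriter, Real.volume_Ico]
  congr 1
  ring

lemma tendsto_nat_log_two : Tendsto (Nat.log 2) atTop atTop :=
  tendsto_atTop_atTop.2 fun b => ⟨2 ^ b, fun a ha => by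
    simpa [Nat.log_pow] using Nat.log_mono_right (b := 2) ha⟩

lemma tendsto_volume_typewriter : Tendsto (fun k => volume (typewriter k)) atTop (𝓝 0) := by
  simp_rw [volume_typewriter]
  have h : Tendsto (fun n : ℕ => ((2 : ℝ) ^ n)⁻¹) atTop (𝓝 0) :=
    (tendsto_pow_atTop_atTop_of_one_lt one_lt_two).inv_tendsto_atTop
  simpa using ENNReal.tendsto_ofReal (h.comp tendsto_nat_log_two)

lemma exists_gt_mem_typewriter {x : ℝ} (hx : x ∈ Set.Ico (0 : ℝ) 1) (n : ℕ) :
    ∃ k > n, x ∈ typewriter (k + 1) := by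
  have hpos : (0 : ℝ) < 2 ^ (n + 2) := by positivity
  have hnn : 0 ≤ x * 2 ^ (n + 2) := mul_nonneg hx.1 hpos.le
  have hlt : ⌊x * 2 ^ (n + 2)⌋₊ < 2 ^ (n + 2) := by
    rw [Nat.floor_lt hnn]
    push_cast
    nlinarith [hx.2]
  have hle := Nat.floor_le hnn
  have hlt' := Nat.lt_floor_add_one (x * 2 ^ (n + 2))
  set j := ⌊x * 2 ^ (n + 2)⌋₊
  have hn : n + 2 < 2 ^ (n + 2) := Nat.lt_two_pow_self
  refine ⟨2 ^ (n + 2) + j - 1, by omega, ?_⟩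
  have hk : 2 ^ (n + 2) + j - 1 + 1 = 2 ^ (n + 2) + j := by omega
  have hlog : Nat.log 2 (2 ^ (n + 2) + j) = n + 2 :=
    Nat.log_eq_of_pow_le_of_lt_pow (by omega) (by rw [pow_succ 2 (n + 2)]; omega)
  rw [hk, typewriter, hlog]
  constructor
  · rw [sub_le_iff_le_add, div_le_iff₀ hpos]
    push_cast
    linarith
  · rw [lt_sub_iff_add_lt, lt_div_iff₀ hpos]
    push_cast
    linarith

/-- If the measures of the sets `A k` tend to zero, then random variables of the form
`1 + c k • 1_{A k}` converge in distribution to `1`. -/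
lemma tendsto_integral_one_add_indicator {Ω : Type*} [MeasurableSpace Ω] {P : Measure Ω}
    [IsProbabilityMeasure P] {A : ℕ → Set Ω} (hA : ∀ k, MeasurableSet (A k))
    (h : Tendsto (fun k => P (A k)) atTop (𝓝 0)) (c : ℕ → ℝ) (g : BoundedContinuousFunction ℝ ℝ) :
    Tendsto (fun k => ∫ ω, g (1 + (A k).indicator (fun _ => c k) ω) ∂P) atTop (𝓝 (g 1)) := by
  have hint (k : ℕ) : ∫ ω, g (1 + (A k).indicator (fun _ => c k) ω) ∂P =
      g 1 + P.real (A k) * (g (1 + c k) - g 1) := by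
    have hg : (fun ω => g (1 + (A k).indicator (fun _ => c k) ω)) =
        fun ω => g 1 + (A k).indicator (fun _ => g (1 + c k) - g 1) ω := by
      ext ω
      by_cases hω : ω ∈ A k <;> simp [hω]
    rw [hg, integral_add (integrable_const _) ((integrable_const _).indicator (hA k)),
      integral_indicator_const _ (hA k)]
    simp
  simp_rw [hint]
  have hreal : Tendsto (fun k => P.real (A k)) atTop (𝓝 0) := by
    simpa [Function.comp_def, measureReal_def] using
      (ENNReal.tendsto_toReal ENNReal.zero_ne_top).comp h
  have hzero : Tendsto (fun k => P.real (A k) * (g (1 + c k) - g 1)) atTop (𝓝 0) := by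
    refine squeeze_zero_norm (a := fun k => P.real (A k) * (2 * ‖g‖)) (fun k => ?_)
      (by simpa using hreal.mul_const (2 * ‖g‖))
    rw [norm_mul, Real.norm_of_nonneg measureReal_nonneg, ← dist_eq_norm]
    gcongr
    exact g.dist_le_two_norm _ _
  simpa using hzero.const_add (g 1)

/-- **Counterexample to the converse of the discrete limit version of Jeulin's lemma
(Shiga).** There exist a probability space, a non-negative measurable process
`(V(k) : k ≥ 1)`, a positive function `Φ` and a non-negative function `f` on the
positive integers such that `V(k)/Φ(k)` converges in distribution to the constant `1`,
`∑_{k≥1} f(k) Φ(k) < ∞`, but almost surely `∑_{k≥1} f(k) V(k) = ∞`. -/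
theorem stmt9 :
    ∃ (Ω : Type) (_ : MeasurableSpace Ω) (P : Measure Ω)
      (V : ℕ → Ω → ℝ) (Φ : ℕ → ℝ) (f : ℕ → ℝ),
      IsProbabilityMeasure P ∧
      (∀ k, Measurable (V k)) ∧
      (∀ k, 1 ≤ k → ∀ ω, 0 ≤ V k ω) ∧
      (∀ k, 1 ≤ k → 0 < Φ k) ∧
      (∀ k, 1 ≤ k → 0 ≤ f k) ∧
      (∀ g : BoundedContinuousFunction ℝ ℝ,
        Tendsto (fun k : ℕ => ∫ ω, g (V k ω / Φ k) ∂P) atTop (𝓝 (g 1))) ∧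
      (∑' k : ℕ, ENNReal.ofReal (f (k + 1) * Φ (k + 1)) < ∞) ∧
      P {ω | ∑' k : ℕ, ENNReal.ofReal (f (k + 1) * V (k + 1) ω) = ∞} = 1 := by
  have hP : IsProbabilityMeasure (volume.restrict (Set.Ico (0 : ℝ) 1)) := ⟨by simp⟩
  refine ⟨ℝ, inferInstance, volume.restrict (Set.Ico 0 1),
    fun k ω => 1 + (typewriter k).indicator (fun _ => 2 ^ k) ω, fun _ => 1,
    fun k => (1 / 2) ^ k, hP, fun k => ?_, fun k _ ω => ?_, fun _ _ => one_pos,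
    fun k _ => by positivity, fun g => ?_, ?_, ?_⟩
  · exact measurable_const.add (measurable_const.indicator (measurableSet_typewriter k))
  · exact add_nonneg zero_le_one (Set.indicator_nonneg (fun _ _ => by positivity) ω)
  · simp only [div_one]
    exact tendsto_integral_one_add_indicator measurableSet_typewriter
      (tendsto_of_tendsto_of_tendsto_of_le_of_le tendsto_const_nhds tendsto_volume_typewriter
        (fun _ => zero_le) fun _ => Measure.restrict_apply_le _ _) _ g
  · simp only [mul_one]
    exact ((summable_nat_add_iff 1).2 summable_geometric_two).tsum_ofReal_lt_top
  · refine (measure_congr (eventuallyEq_univ.2 ?_)).trans measure_univ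
    filter_upwards [ae_restrict_mem measurableSet_Ico] with ω hω
    by_contra hfin
    refine Set.infinite_of_forall_exists_gt (fun n => ?_)
      (ENNReal.finite_const_le_of_tsum_ne_top hfin one_ne_zero)
    obtain ⟨k, hk, hmem⟩ := exists_gt_mem_typewriter hω n
    refine ⟨k, ?_, hk⟩
    have hpow : (1 / 2 : ℝ) ^ (k + 1) * 2 ^ (k + 1) = 1 := by
      rw [← mul_pow]
      norm_num
    have hpos : (0 : ℝ) < (1 / 2) ^ (k + 1) := by positivity
    rw [Set.mem_ofPred_eq, ENNReal.one_le_ofReal, Set.indicator_of_mem hmem, mul_add, hpow]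
    linarith
end

section
/- Let ‖·‖ be a norm on ℝ^d taking non-negative integer values on ℤ^d and set N(k) = #{x ∈ ℤ^d : ‖x‖ = k}. Suppose there exists k_0 ≥ 1 such that N(k) is non-decreasing in k for k ≥ k_0. Then there exist k_1 ≥ 1 and positive constants c_1, c_2 such that c_1 k^{d−1} ≤ N(k) ≤ c_2 k^{d−1} for all k ≥ k_1. -/
open Filter
open scoped Topology

/-- A norm on `ℝ^d` is comparable to the supremum norm, with natural-number constants. -/
theorem exists_nat_equiv_sup_norm (d : ℕ) (nrm : (Fin d → ℝ) → ℝ)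
    (hnrm0 : ∀ x, nrm x = 0 ↔ x = 0)
    (hnrm_smul : ∀ (a : ℝ) x, nrm (a • x) = |a| * nrm x)
    (hnrm_add : ∀ x y, nrm (x + y) ≤ nrm x + nrm y) :
    ∃ L C : ℕ, 0 < L ∧ ∀ x, nrm x ≤ L * ‖x‖ ∧ ‖x‖ ≤ C * nrm x := by
  let p : Seminorm ℝ (Fin d → ℝ) := Seminorm.of nrm hnrm_add hnrm_smul
  have hcont : Continuous p := by
    have h := p.convexOn.continuousOn_interior
    rwa [interior_univ, continuousOn_univ] at h
  obtain ⟨M, hM, hMle⟩ := p.bound_of_continuous_normedSpace hcont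
  obtain ⟨c, hc, hcle⟩ : ∃ c : ℝ, 0 < c ∧ ∀ x, c * ‖x‖ ≤ p x := by
    rcases (Metric.sphere (0 : Fin d → ℝ) 1).eq_empty_or_nonempty with he | hne
    · refine ⟨1, one_pos, fun x => ?_⟩
      rcases eq_or_ne x 0 with rfl | hx
      · simp
      · have : (‖x‖⁻¹ • x) ∈ Metric.sphere (0 : Fin d → ℝ) 1 := by
          simp [norm_smul, hx]
        simp [he] at this
    · obtain ⟨y, hy, hmin⟩ := (isCompact_sphere (0 : Fin d → ℝ) 1).exists_isMinOn hne
        hcont.continuousOn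
      have hy0 : y ≠ 0 := ne_zero_of_mem_unit_sphere ⟨y, hy⟩
      refine ⟨p y, lt_of_le_of_ne (apply_nonneg p y) fun h => hy0 ((hnrm0 y).1 h.symm),
        fun x => ?_⟩
      rcases eq_or_ne x 0 with rfl | hx
      · simp
      · have hx' : 0 < ‖x‖ := norm_pos_iff.2 hx
        have hmem : (‖x‖⁻¹ • x) ∈ Metric.sphere (0 : Fin d → ℝ) 1 := by
          simp [norm_smul, hx]
        have h : p y ≤ p (‖x‖⁻¹ • x) := hmin hmem
        rw [map_smul_eq_mul, norm_inv, norm_norm, inv_mul_eq_div, le_div_iff₀ hx'] at h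
        exact h
  obtain ⟨L, hL⟩ := exists_nat_ge M
  obtain ⟨C, hC⟩ := exists_nat_ge c⁻¹
  refine ⟨L, C, by exact_mod_cast hM.trans_le hL, fun x => ⟨?_, ?_⟩⟩
  · exact (hMle x).trans (by gcongr)
  · have h1 : ‖x‖ ≤ c⁻¹ * p x := by
      rw [inv_mul_eq_div, le_div_iff₀ hc, mul_comm]
      exact hcle x
    exact h1.trans (mul_le_mul_of_nonneg_right hC (apply_nonneg p x))

/-- The partial sums of the sphere-counting function count lattice points in balls. -/
theorem sum_ncard_fiber_eq_card_filter {α : Type*} (f : α → ℕ) (k : ℕ) (s : Finset α)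
    (hs : ∀ x, f x ≤ k → x ∈ s) :
    ∑ j ∈ Finset.range (k + 1), Set.ncard {x | f x = j} = (s.filter fun x => f x ≤ k).card := by
  classical
  rw [Finset.card_eq_sum_card_fiberwise (f := f) (t := Finset.range (k + 1))]
  · refine Finset.sum_congr rfl fun j hj => ?_
    rw [← Set.ncard_coe_finset]
    congr 1
    ext x
    have hj' : j ≤ k := Nat.lt_succ_iff.1 (Finset.mem_range.1 hj)
    simp only [Set.mem_ofPred_eq, Finset.coe_filter, Finset.mem_filter]
    exact ⟨fun h => ⟨⟨hs x (h.trans_le hj'), h.trans_le hj'⟩, h⟩, fun h => h.2⟩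
  · intro x hx
    simpa [Nat.lt_succ_iff] using (Finset.mem_filter.1 hx).2

/-- The number of lattice points in a ball of radius `k` is of order `k ^ d`. -/
theorem exists_bounds_sum_ncard_sphere (d : ℕ) (nrm : (Fin d → ℝ) → ℝ)
    (hnrm0 : ∀ x, nrm x = 0 ↔ x = 0)
    (hnrm_smul : ∀ (a : ℝ) x, nrm (a • x) = |a| * nrm x)
    (hnrm_add : ∀ x y, nrm (x + y) ≤ nrm x + nrm y)
    (nrmZ : (Fin d → ℤ) → ℕ)
    (hnrmZ : ∀ x : Fin d → ℤ, ((nrmZ x : ℕ) : ℝ) = nrm (fun i => ((x i : ℤ) : ℝ))) :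
    ∃ A B : ℝ, 0 < A ∧ 0 < B ∧ ∀ k : ℕ, 1 ≤ k →
      A * (k : ℝ) ^ d ≤ ∑ j ∈ Finset.range (k + 1), (Set.ncard {x | nrmZ x = j} : ℝ) ∧
      ∑ j ∈ Finset.range (k + 1), (Set.ncard {x | nrmZ x = j} : ℝ) ≤ B * (k : ℝ) ^ d := by
  obtain ⟨L, C, hL, hLC⟩ := exists_nat_equiv_sup_norm d nrm hnrm0 hnrm_smul hnrm_add
  have hL' : (0 : ℝ) < L := by exact_mod_cast hL
  refine ⟨((L : ℝ)⁻¹) ^ d, (2 * C + 1) ^ d, by positivity, by positivity, fun k hk => ?_⟩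
  let s : Finset (Fin d → ℤ) :=
    Finset.Icc (fun _ => -((C * k : ℕ) : ℤ)) (fun _ => ((C * k : ℕ) : ℤ))
  have hs : ∀ x, nrmZ x ≤ k → x ∈ s := by
    intro x hx
    have hnorm : ‖fun i => ((x i : ℤ) : ℝ)‖ ≤ (C * k : ℕ) := by
      refine (hLC _).2.trans ?_
      rw [← hnrmZ]
      exact_mod_cast Nat.mul_le_mul_left C hx
    have hcoord : ∀ i, |x i| ≤ ((C * k : ℕ) : ℤ) := by
      intro i
      have h := (norm_le_pi_norm (fun i => ((x i : ℤ) : ℝ)) i).trans hnorm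
      rw [Real.norm_eq_abs] at h
      exact_mod_cast h
    exact Finset.mem_Icc.2 ⟨fun i => (abs_le.1 (hcoord i)).1, fun i => (abs_le.1 (hcoord i)).2⟩
  have hsum := sum_ncard_fiber_eq_card_filter nrmZ k s hs
  rw [← Nat.cast_sum, hsum]
  constructor
  · let b : Finset (Fin d → ℤ) := Finset.Icc 0 (fun _ => ((k / L : ℕ) : ℤ))
    have hb : b ⊆ s.filter fun x => nrmZ x ≤ k := by
      intro x hx
      have hx' := Finset.mem_Icc.1 hx
      have hle : nrmZ x ≤ k := by
        have hnorm : ‖fun i => ((x i : ℤ) : ℝ)‖ ≤ ((k / L : ℕ) : ℝ) := by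
          refine (pi_norm_le_iff_of_nonneg (Nat.cast_nonneg _)).2 fun i => ?_
          have h0 : 0 ≤ x i := hx'.1 i
          have h1 : x i ≤ ((k / L : ℕ) : ℤ) := hx'.2 i
          rw [Real.norm_eq_abs, abs_of_nonneg (by exact_mod_cast h0)]
          simpa only [Int.cast_natCast] using (Int.cast_le (R := ℝ)).2 h1
        have h : (nrmZ x : ℝ) ≤ L * ((k / L : ℕ) : ℝ) := by
          rw [hnrmZ]
          exact (hLC _).1.trans (by gcongr)
        exact (by exact_mod_cast h : nrmZ x ≤ L * (k / L)).trans (Nat.mul_div_le k L)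
      exact Finset.mem_filter.2 ⟨hs x hle, hle⟩
    have hcard : b.card = (k / L + 1) ^ d := by
      simp only [b, Pi.card_Icc, Int.card_Icc, Pi.zero_apply, Finset.prod_const,
        Finset.card_univ, Fintype.card_fin]
      congr 1
    have hdiv : (L : ℝ)⁻¹ * k ≤ ((k / L + 1 : ℕ) : ℝ) := by
      rw [inv_mul_eq_div, div_le_iff₀ hL', mul_comm]
      exact_mod_cast (Nat.lt_mul_div_succ k hL).le
    calc ((L : ℝ)⁻¹) ^ d * (k : ℝ) ^ d = ((L : ℝ)⁻¹ * k) ^ d := (mul_pow _ _ _).symm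
      _ ≤ ((k / L + 1 : ℕ) : ℝ) ^ d := by gcongr
      _ = (b.card : ℝ) := by rw [hcard, Nat.cast_pow]
      _ ≤ _ := by exact_mod_cast Finset.card_le_card hb
  · have hcard : s.card = (2 * (C * k) + 1) ^ d := by
      simp only [s, Pi.card_Icc, Int.card_Icc, Finset.prod_const,
        Finset.card_univ, Fintype.card_fin]
      congr 1
      omega
    have hk' : (1 : ℝ) ≤ k := by exact_mod_cast hk
    calc ((s.filter fun x => nrmZ x ≤ k).card : ℝ) ≤ s.card := by
          exact_mod_cast Finset.card_filter_le _ _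
      _ = (2 * (C * k) + 1 : ℝ) ^ d := by rw [hcard]; push_cast; rfl
      _ ≤ ((2 * C + 1) * k : ℝ) ^ d := by gcongr; linarith
      _ = _ := mul_pow _ _ _

/-- An eventually monotone sequence whose partial sums are of order `k ^ d` is itself of order
`k ^ (d - 1)`. -/
theorem exists_bounds_of_sum_bounds (d : ℕ) (hd : 1 ≤ d) (f : ℕ → ℝ) (hf : ∀ k, 0 ≤ f k)
    (k₀ : ℕ) (hmono : ∀ k, k₀ ≤ k → f k ≤ f (k + 1)) (A B : ℝ) (hA : 0 < A) (hB : 0 < B)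
    (hS : ∀ k : ℕ, 1 ≤ k → A * (k : ℝ) ^ d ≤ ∑ j ∈ Finset.range (k + 1), f j ∧
      ∑ j ∈ Finset.range (k + 1), f j ≤ B * (k : ℝ) ^ d) :
    ∃ k₁ : ℕ, 1 ≤ k₁ ∧ ∃ c₁ c₂ : ℝ, 0 < c₁ ∧ 0 < c₂ ∧ ∀ k : ℕ, k₁ ≤ k →
      c₁ * (k : ℝ) ^ (d - 1) ≤ f k ∧ f k ≤ c₂ * (k : ℝ) ^ (d - 1) := by
  have hle : ∀ m n, k₀ ≤ m → m ≤ n → f m ≤ f n := by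
    intro m n hm hmn
    induction n, hmn using Nat.le_induction with
    | base => exact le_rfl
    | succ n hn ih => exact ih.trans (hmono n (hm.trans hn))
  obtain ⟨L, hL⟩ := exists_nat_ge (max 1 (2 * B / A))
  have hL1 : (1 : ℝ) ≤ L := (le_max_left _ _).trans hL
  have hL2 : 2 * B / A ≤ L := (le_max_right _ _).trans hL
  have hLpos : 0 < L := by exact_mod_cast one_pos.trans_le hL1
  refine ⟨L * (k₀ + 1), Nat.mul_pos hLpos k₀.succ_pos, A / 2, B * 2 ^ d, by positivity,
    by positivity, fun k hk => ?_⟩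
  have hkk : k₀ + 1 ≤ k := (Nat.le_mul_of_pos_left _ hLpos).trans hk
  have hk' : (0 : ℝ) < k := by exact_mod_cast (by omega : 0 < k)
  have hpow : (k : ℝ) ^ d = (k : ℝ) ^ (d - 1) * k := by
    rw [← pow_succ, Nat.sub_add_cancel hd]
  constructor
  · set m := k / L with hm
    have hm0 : k₀ + 1 ≤ m := by
      rw [hm, Nat.le_div_iff_mul_le hLpos, mul_comm]
      exact hk
    have hmk : m ≤ k := Nat.div_le_self _ _
    have hsplit := Finset.sum_range_add_sum_Ico f (Nat.add_le_add_right hmk 1)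
    have hIco : ∑ j ∈ Finset.Ico (m + 1) (k + 1), f j ≤ k * f k := by
      calc ∑ j ∈ Finset.Ico (m + 1) (k + 1), f j
          ≤ ∑ _j ∈ Finset.Ico (m + 1) (k + 1), f k := by
            refine Finset.sum_le_sum fun j hj => ?_
            rw [Finset.mem_Ico] at hj
            exact hle j k (by omega) (by omega)
        _ = ((k - m : ℕ) : ℝ) * f k := by simp
        _ ≤ k * f k := by
            gcongr
            · exact hf k
            · exact Nat.sub_le _ _
    have hmL : (L : ℝ) * m ≤ k := by exact_mod_cast Nat.mul_div_le k L
    have hLpow : (L : ℝ) * (m : ℝ) ^ d ≤ (k : ℝ) ^ d := by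
      calc (L : ℝ) * (m : ℝ) ^ d ≤ (L : ℝ) ^ d * (m : ℝ) ^ d := by
            gcongr
            exact le_self_pow₀ hL1 (by omega)
        _ = ((L : ℝ) * m) ^ d := (mul_pow _ _ _).symm
        _ ≤ (k : ℝ) ^ d := by gcongr
    have hBm : B * (m : ℝ) ^ d ≤ A / 2 * (k : ℝ) ^ d := by
      have hBL : B ≤ A / 2 * L := by
        rw [div_le_iff₀ hA] at hL2
        linarith
      calc B * (m : ℝ) ^ d ≤ A / 2 * L * (m : ℝ) ^ d := by gcongr
        _ = A / 2 * (L * (m : ℝ) ^ d) := mul_assoc _ _ _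
        _ ≤ A / 2 * (k : ℝ) ^ d := by gcongr
    have h1 := (hS k (by omega)).1
    have h2 := (hS m (by omega)).2
    refine le_of_mul_le_mul_right ?_ hk'
    rw [mul_assoc, ← hpow]
    linarith
  · have h1 : k * f k ≤ ∑ j ∈ Finset.range (2 * k + 1), f j := by
      calc k * f k ≤ ((2 * k + 1 - k : ℕ) : ℝ) * f k := by
            gcongr
            · exact hf k
            · omega
        _ = ∑ _j ∈ Finset.Ico k (2 * k + 1), f k := by simp
        _ ≤ ∑ j ∈ Finset.Ico k (2 * k + 1), f j := by
            refine Finset.sum_le_sum fun j hj => ?_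
            exact hle k j (by omega) (Finset.mem_Ico.1 hj).1
        _ ≤ ∑ j ∈ Finset.range (2 * k + 1), f j := by
            refine Finset.sum_le_sum_of_subset_of_nonneg (fun j hj => ?_) fun j _ _ => hf j
            exact Finset.mem_range.2 (Finset.mem_Ico.1 hj).2
    have h2 := (hS (2 * k) (by omega)).2
    refine le_of_mul_le_mul_right ?_ hk'
    rw [mul_assoc (B * 2 ^ d), ← hpow, mul_assoc B, ← mul_pow, mul_comm (f k)]
    exact_mod_cast h1.trans h2

/-- If a norm on `ℝ^d` takes non-negative integer values on `ℤ^d` and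
`N(k) = #{x ∈ ℤ^d : ‖x‖ = k}` is non-decreasing for `k ≥ k₀`, then
`N(k) ≍ k^{d-1}` for all large `k`. -/
theorem stmt13
    (d : ℕ) (hd : 1 ≤ d)
    (nrm : (Fin d → ℝ) → ℝ)
    (hnrm0 : ∀ x, nrm x = 0 ↔ x = 0)
    (hnrm_smul : ∀ (a : ℝ) x, nrm (a • x) = |a| * nrm x)
    (hnrm_add : ∀ x y, nrm (x + y) ≤ nrm x + nrm y)
    (nrmZ : (Fin d → ℤ) → ℕ)
    (hnrmZ : ∀ x : Fin d → ℤ, ((nrmZ x : ℕ) : ℝ) = nrm (fun i => ((x i : ℤ) : ℝ)))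
    (N : ℕ → ℕ)
    (hN : ∀ k, N k = Set.ncard {x : Fin d → ℤ | nrmZ x = k})
    (k₀ : ℕ) (hk₀ : 1 ≤ k₀)
    (hmono : ∀ k, k₀ ≤ k → N k ≤ N (k + 1)) :
    ∃ k₁ : ℕ, 1 ≤ k₁ ∧ ∃ c₁ c₂ : ℝ, 0 < c₁ ∧ 0 < c₂ ∧
      ∀ k : ℕ, k₁ ≤ k →
        c₁ * (k : ℝ) ^ (d - 1) ≤ (N k : ℝ) ∧ (N k : ℝ) ≤ c₂ * (k : ℝ) ^ (d - 1) := by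
  obtain ⟨A, B, hA, hB, hS⟩ :=
    exists_bounds_sum_ncard_sphere d nrm hnrm0 hnrm_smul hnrm_add nrmZ hnrmZ
  simp only [← hN] at hS
  exact exists_bounds_of_sum_bounds d hd (fun k => (N k : ℝ)) (fun k => Nat.cast_nonneg _) k₀
    (fun k hk => Nat.cast_le.2 (hmono k hk)) A B hA hB hS
end

section
/- Consider the weighted ℓ¹-norm ‖x‖_{w1}^{(d)} = ∑_{i=1}^d i |x^i| on ℝ^d and let N_{w1}^{(d)}(k) = #{x ∈ ℤ^d : ‖x‖_{w1}^{(d)} = k}. Then for d = 2: N_{w1}^{(2)}(0) = 1 and N_{w1}^{(2)}(k) = 2k for every k ≥ 1. For d = 3: N_{w1}^{(3)}(0) = 1; N_{w1}^{(3)}(k) = (2/3)k² + 2 if k ≥ 1 and k ≡ 0 (mod 3); and N_{w1}^{(3)}(k) = (2/3)k² + 4/3 if k ≡ 1 or 2 (mod 3). -/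
open Filter
open scoped Topology

/-- The integer points of weighted `ℓ¹`-norm `k` in dimension `n`. -/
def weightedSphere (n k : ℕ) : Set (Fin n → ℤ) :=
  {x | (∑ i, (i.val + 1) * (x i).natAbs) = k}

theorem snoc_mem_weightedSphere {n k : ℕ} (x : Fin n → ℤ) (c : ℤ) :
    (Fin.snoc x c : Fin (n + 1) → ℤ) ∈ weightedSphere (n + 1) k ↔
      (∑ i, (i.val + 1) * (x i).natAbs) + (n + 1) * c.natAbs = k := by
  simp [weightedSphere, Fin.sum_univ_castSucc]

/-- Points of small norm have vanishing last coordinate. -/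
theorem encard_weightedSphere_of_lt {n k : ℕ} (h : k < n + 1) :
    (weightedSphere (n + 1) k).encard = (weightedSphere n k).encard := by
  have hinj : Function.Injective (fun x : Fin n → ℤ => (Fin.snoc x 0 : Fin (n + 1) → ℤ)) :=
    fun x y hxy => (Fin.snoc_inj.1 hxy).1
  rw [← hinj.encard_image]
  congr 1
  ext x
  induction x using Fin.snocCases with
  | snoc x c =>
    rw [snoc_mem_weightedSphere]
    simp only [Set.mem_image, Fin.snoc_inj]
    constructor
    · intro hx
      have hc : c = 0 := by
        by_contra hc
        have := Nat.le_mul_of_pos_right (n + 1) (Int.natAbs_pos.2 hc)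
        omega
      subst hc
      exact ⟨x, by simpa [weightedSphere] using hx, rfl, rfl⟩
    · rintro ⟨y, hy, rfl, rfl⟩
      simpa [weightedSphere] using hy

/-- The bijection of `ℤ` onto `ℤ \ {0, 1}` that increases absolute values by one. -/
def stretch (c : ℤ) : ℤ := if 0 < c then c + 1 else c - 1

theorem stretch_injective : Function.Injective stretch := by
  intro a b h
  unfold stretch at h
  split_ifs at h <;> omega

theorem natAbs_stretch (c : ℤ) : (stretch c).natAbs = c.natAbs + 1 := by
  unfold stretch
  split_ifs <;> omega

theorem exists_stretch_eq {c : ℤ} (h0 : c ≠ 0) (h1 : c ≠ 1) : ∃ b, stretch b = c := by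
  unfold stretch
  by_cases h : 0 < c
  · exact ⟨c - 1, by split_ifs <;> omega⟩
  · exact ⟨c + 1, by split_ifs <;> omega⟩

theorem stretch_ne_zero (c : ℤ) : stretch c ≠ 0 := by
  unfold stretch
  split_ifs <;> omega

theorem stretch_ne_one (c : ℤ) : stretch c ≠ 1 := by
  unfold stretch
  split_ifs <;> omega

/-- Shifting the last coordinate away from zero relates spheres whose radii differ by the weight
of that coordinate. -/
theorem encard_weightedSphere_add (n k : ℕ) :
    (weightedSphere (n + 1) (k + (n + 1))).encard =
      (weightedSphere (n + 1) k).encard + (weightedSphere n k).encard +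
        (weightedSphere n (k + (n + 1))).encard := by
  let f (c : ℤ) (x : Fin n → ℤ) : Fin (n + 1) → ℤ := Fin.snoc x c
  let g (x : Fin (n + 1) → ℤ) : Fin (n + 1) → ℤ :=
    Fin.snoc (Fin.init x) (stretch (x (Fin.last n)))
  have hf (c : ℤ) : Function.Injective (f c) := fun x y hxy => (Fin.snoc_inj.1 hxy).1
  have hg : Function.Injective g := by
    intro x y hxy
    obtain ⟨h1, h2⟩ := Fin.snoc_inj.1 hxy
    rw [← Fin.snoc_init_self x, ← Fin.snoc_init_self y, h1, stretch_injective h2]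
  have hunion : weightedSphere (n + 1) (k + (n + 1)) =
      g '' weightedSphere (n + 1) k ∪ f 1 '' weightedSphere n k ∪
        f 0 '' weightedSphere n (k + (n + 1)) := by
    ext x
    constructor
    · intro hx
      induction x using Fin.snocCases with
      | snoc x c =>
        rw [snoc_mem_weightedSphere] at hx
        by_cases h0 : c = 0
        · subst h0
          exact Or.inr ⟨x, by simpa [weightedSphere] using hx, rfl⟩
        by_cases h1 : c = 1
        · subst h1
          exact Or.inl (Or.inr ⟨x, by simpa [weightedSphere] using hx, rfl⟩)
        obtain ⟨b, rfl⟩ := exists_stretch_eq h0 h1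
        refine Or.inl (Or.inl ⟨Fin.snoc x b, ?_, by simp [g]⟩)
        rw [natAbs_stretch] at hx
        rw [snoc_mem_weightedSphere]
        linarith
    · rintro ((⟨x, hx, rfl⟩ | ⟨x, hx, rfl⟩) | ⟨x, hx, rfl⟩)
      · rw [← Fin.snoc_init_self x, snoc_mem_weightedSphere] at hx
        rw [snoc_mem_weightedSphere, natAbs_stretch]
        linarith
      · rw [snoc_mem_weightedSphere]
        simpa [weightedSphere] using hx
      · rw [snoc_mem_weightedSphere]
        simpa [weightedSphere] using hx
  rw [hunion, Set.encard_union_eq, Set.encard_union_eq, hg.encard_image,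
    (hf 1).encard_image, (hf 0).encard_image]
  · rw [Set.disjoint_left]
    rintro _ ⟨x, -, rfl⟩ ⟨y, -, h⟩
    exact stretch_ne_one _ (Fin.snoc_inj.1 h).2.symm
  · rw [Set.disjoint_left]
    rintro _ (⟨x, -, rfl⟩ | ⟨x, -, rfl⟩) ⟨y, -, h⟩
    · exact stretch_ne_zero _ (Fin.snoc_inj.1 h).2.symm
    · exact zero_ne_one (Fin.snoc_inj.1 h).2

theorem encard_weightedSphere_zero (n : ℕ) : (weightedSphere n 0).encard = 1 := by
  induction n with
  | zero =>
    have : weightedSphere 0 0 = Set.univ := by ext; simp [weightedSphere]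
    simp [this]
  | succ n ih => rw [encard_weightedSphere_of_lt n.succ_pos, ih]

theorem encard_weightedSphere_zero_succ (k : ℕ) : (weightedSphere 0 (k + 1)).encard = 0 := by
  simp [weightedSphere]

theorem encard_weightedSphere_one_succ (k : ℕ) : (weightedSphere 1 (k + 1)).encard = 2 := by
  induction k with
  | zero =>
    rw [encard_weightedSphere_add 0 0]
    simp only [encard_weightedSphere_zero, zero_add, encard_weightedSphere_zero_succ]
    norm_num
  | succ k ih =>
    rw [encard_weightedSphere_add 0 (k + 1)]
    simp [ih, encard_weightedSphere_zero_succ]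

theorem encard_weightedSphere_two_succ (k : ℕ) :
    (weightedSphere 2 (k + 1)).encard = ((2 * (k + 1) : ℕ) : ℕ∞) := by
  induction k using Nat.strong_induction_on with
  | _ k ih =>
    match k with
    | 0 => rw [encard_weightedSphere_of_lt (by norm_num), encard_weightedSphere_one_succ]; rfl
    | 1 =>
      rw [encard_weightedSphere_add 1 0, encard_weightedSphere_zero, encard_weightedSphere_zero,
        encard_weightedSphere_one_succ]
      norm_num
    | k + 2 =>
      rw [show k + 2 + 1 = k + 1 + (1 + 1) by ring, encard_weightedSphere_add 1 (k + 1),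
        ih k (by omega), encard_weightedSphere_one_succ k,
        show k + 1 + (1 + 1) = (k + 2) + 1 by ring, encard_weightedSphere_one_succ]
      norm_cast

/-- The closed form in dimension three, with denominators cleared. -/
theorem encard_weightedSphere_three_succ (k : ℕ) :
    ∃ m : ℕ, (weightedSphere 3 (k + 1)).encard = m ∧
      3 * m = 2 * (k + 1) ^ 2 + if (k + 1) % 3 = 0 then 6 else 4 := by
  induction k using Nat.strong_induction_on with
  | _ k ih =>
    match k with
    | 0 =>
      refine ⟨2, ?_, by norm_num⟩
      rw [encard_weightedSphere_of_lt (by norm_num), encard_weightedSphere_two_succ]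
    | 1 =>
      refine ⟨4, ?_, by norm_num⟩
      rw [encard_weightedSphere_of_lt (by norm_num), encard_weightedSphere_two_succ]
    | 2 =>
      refine ⟨8, ?_, by norm_num⟩
      rw [encard_weightedSphere_add 2 0, encard_weightedSphere_zero, encard_weightedSphere_zero,
        encard_weightedSphere_two_succ]
      norm_num
    | k + 3 =>
      obtain ⟨m, hm, h⟩ := ih k (by omega)
      refine ⟨m + 2 * (k + 1) + 2 * (k + 3 + 1), ?_, ?_⟩
      · rw [show k + 3 + 1 = k + 1 + (2 + 1) by ring, encard_weightedSphere_add 2 (k + 1), hm,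
          encard_weightedSphere_two_succ, show k + 1 + (2 + 1) = (k + 3) + 1 by ring,
          encard_weightedSphere_two_succ]
        norm_cast
      · rw [show (k + 3 + 1) % 3 = (k + 1) % 3 by omega]
        linarith

/-- **Sphere counts for the weighted ℓ¹-norm** `‖x‖ = ∑_i i·|x^i|` in dimensions
`2` and `3`: `N^{(2)}(0) = 1`, `N^{(2)}(k) = 2k` for `k ≥ 1`; `N^{(3)}(0) = 1`,
`N^{(3)}(k) = (2/3)k² + 2` for `k ≥ 1` with `k ≡ 0 (mod 3)`, and
`N^{(3)}(k) = (2/3)k² + 4/3` for `k ≡ 1, 2 (mod 3)`. -/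
theorem stmt18
    (N₂ N₃ : ℕ → ℕ)
    (hN₂ : ∀ k, N₂ k =
      Set.ncard {x : Fin 2 → ℤ | (∑ i, (i.val + 1) * (x i).natAbs) = k})
    (hN₃ : ∀ k, N₃ k =
      Set.ncard {x : Fin 3 → ℤ | (∑ i, (i.val + 1) * (x i).natAbs) = k}) :
    N₂ 0 = 1 ∧
    (∀ k : ℕ, 1 ≤ k → N₂ k = 2 * k) ∧
    N₃ 0 = 1 ∧
    (∀ k : ℕ, 1 ≤ k → k % 3 = 0 → (N₃ k : ℝ) = 2 / 3 * (k : ℝ) ^ 2 + 2) ∧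
    (∀ k : ℕ, k % 3 = 1 ∨ k % 3 = 2 → (N₃ k : ℝ) = 2 / 3 * (k : ℝ) ^ 2 + 4 / 3) := by
  have hN₃_succ (k : ℕ) : 3 * N₃ (k + 1) =
      2 * (k + 1) ^ 2 + if (k + 1) % 3 = 0 then 6 else 4 := by
    obtain ⟨m, hm, h⟩ := encard_weightedSphere_three_succ k
    have : N₃ (k + 1) = m := by
      rw [hN₃]
      exact congrArg ENat.toNat hm
    rw [this, h]
  refine ⟨?_, ?_, ?_, ?_, ?_⟩
  · rw [hN₂]
    exact congrArg ENat.toNat (encard_weightedSphere_zero 2)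
  · intro k hk
    obtain ⟨k, rfl⟩ := Nat.exists_eq_add_of_le' hk
    rw [hN₂]
    exact congrArg ENat.toNat (encard_weightedSphere_two_succ k)
  · rw [hN₃]
    exact congrArg ENat.toNat (encard_weightedSphere_zero 3)
  · intro k hk hmod
    obtain ⟨k, rfl⟩ := Nat.exists_eq_add_of_le' hk
    have h := hN₃_succ k
    rw [if_pos hmod] at h
    have h' : (3 : ℝ) * N₃ (k + 1) = 2 * ((k + 1 : ℕ) : ℝ) ^ 2 + 6 := by exact_mod_cast h
    linarith
  · intro k hmod
    obtain ⟨k, rfl⟩ := Nat.exists_eq_add_of_le' (show 1 ≤ k by omega)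
    have h := hN₃_succ k
    rw [if_neg (by omega)] at h
    have h' : (3 : ℝ) * N₃ (k + 1) = 2 * ((k + 1 : ℕ) : ℝ) ^ 2 + 4 := by exact_mod_cast h
    linarith
end
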